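/- arXiv:math/0703211 — 4 statements merged into one kernel-verified Lean document; each statement's English description precedes it below -/
import Mathlib

section
/- If an infinite relational structure R is almost monomorphic, then its profile φ_R is non-decreasing: φ_R(n) ≤ φ_R(n+1) for every natural number n. -/
open scoped Cardinal

universe u v

variable {α : Type u} {I : Type v}

/-- A relational structure of signature `ar : I → ℕ` on the domain `α` is given by a family
`rel` of `ar i`-ary relations on `α`.  `PreservesRel ar rel A f` says that the map `f`
preserves every relation of the structure on tuples drawn from `A`. -/
def PreservesRel (ar : I → ℕ) (rel : ∀ i, Set (Fin (ar i) → α)) (A : Set α) (f : α → α) :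
    Prop :=
  ∀ (i : I) (x : Fin (ar i) → α), (∀ j, x j ∈ A) → (x ∈ rel i ↔ (f ∘ x) ∈ rel i)

/-- `f` is an isomorphism from the substructure induced on `A` onto the one induced on `B`. -/
def IsLocalIso (ar : I → ℕ) (rel : ∀ i, Set (Fin (ar i) → α)) (A B : Set α) (f : α → α) :
    Prop :=
  Set.BijOn f A B ∧ PreservesRel ar rel A f

/-- The substructures induced on `A` and on `B` are isomorphic. -/
def IsoOn (ar : I → ℕ) (rel : ∀ i, Set (Fin (ar i) → α)) (A B : Set α) : Prop :=
  ∃ f : α → α, IsLocalIso ar rel A B f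

/-- The profile of a relational structure: the number (as a cardinal) of isomorphism classes of
substructures induced on `n`-element subsets of the domain. -/
def profile (ar : I → ℕ) (rel : ∀ i, Set (Fin (ar i) → α)) (n : ℕ) : Cardinal :=
  Cardinal.mk (Quot fun A B : {s : Finset α // s.card = n} =>
    IsoOn ar rel (↑A.1 : Set α) (↑B.1 : Set α))

/-- The profile, as a natural number (meaningful when it takes finite values). -/
noncomputable def profileNat (ar : I → ℕ) (rel : ∀ i, Set (Fin (ar i) → α)) (n : ℕ) : ℕ :=
  Nat.card (Quot fun A B : {s : Finset α // s.card = n} =>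
    IsoOn ar rel (↑A.1 : Set α) (↑B.1 : Set α))

/-- `R` is `F`-monomorphic: any two finite subsets of `E ∖ F` of the same size carry isomorphic
substructures, via an isomorphism whose extension by the identity on `F` is an isomorphism of
the substructures induced on `A ∪ F` and `A' ∪ F`. -/
def FMonomorphic (ar : I → ℕ) (rel : ∀ i, Set (Fin (ar i) → α)) (F : Finset α) : Prop :=
  ∀ A B : Finset α, Disjoint (↑A : Set α) (↑F : Set α) → Disjoint (↑B : Set α) (↑F : Set α) →
    A.card = B.card →
    ∃ f : α → α, (∀ y ∈ F, f y = y) ∧ IsLocalIso ar rel (↑A : Set α) (↑B : Set α) f ∧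
      IsLocalIso ar rel ((↑A : Set α) ∪ ↑F) ((↑B : Set α) ∪ ↑F) f

/-- `R` is `F`-chainable: there is a linear order on `E ∖ F` such that every local isomorphism
of the chain `(E ∖ F, ≤)`, extended by the identity on `F`, is a local isomorphism of `R`. -/
def FChainable (ar : I → ℕ) (rel : ∀ i, Set (Fin (ar i) → α)) (F : Finset α) : Prop :=
  ∃ le : α → α → Prop, IsLinearOrder α le ∧
    ∀ (A B : Set α) (f : α → α), A ⊆ (↑F : Set α)ᶜ → B ⊆ (↑F : Set α)ᶜ →
      Set.BijOn f A B → (∀ a ∈ A, ∀ b ∈ A, (le a b ↔ le (f a) (f b))) →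
      (∀ y ∈ F, f y = y) →
      IsLocalIso ar rel (A ∪ ↑F) (B ∪ ↑F) f

open Classical in
theorem aux_sum_zero (n : ℕ) (f : Finset α → ℚ)
    (hf : ∀ C : Finset α, C.card = n + 1 → ∑ B ∈ C.powersetCard n, f B = 0) :
    ∀ (k : ℕ) (S : Finset α), S.card = n + 1 + k → ∑ B ∈ S.powersetCard n, f B = 0 := by
  intro k
  induction k with
  | zero => intro S hS; exact hf S hS
  | succ k ih =>
    intro S hS
    have h1 : ∑ x ∈ S, ∑ B ∈ (S.erase x).powersetCard n, f B = 0 := by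
      apply Finset.sum_eq_zero
      intro x hx
      apply ih
      rw [Finset.card_erase_of_mem hx]
      omega
    have h2 : ∑ x ∈ S, ∑ B ∈ (S.erase x).powersetCard n, f B
        = ∑ B ∈ S.powersetCard n, ∑ x ∈ S \ B, f B := by
      apply Finset.sum_comm'
      intro x B
      simp only [Finset.mem_powersetCard, Finset.mem_sdiff, Finset.subset_erase]
      tauto
    have h3 : ∑ B ∈ S.powersetCard n, ∑ x ∈ S \ B, f B
        = ∑ B ∈ S.powersetCard n, ((k : ℚ) + 2) * f B := by
      apply Finset.sum_congr rfl
      intro B hB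
      rw [Finset.mem_powersetCard] at hB
      rw [Finset.sum_const, Finset.card_sdiff_of_subset hB.1, hS, hB.2, nsmul_eq_mul]
      have : n + 1 + (k + 1) - n = k + 2 := by omega
      rw [this]; push_cast; ring
    rw [h2, h3, ← Finset.mul_sum] at h1
    rcases mul_eq_zero.1 h1 with h | h
    · exfalso
      have : (0 : ℚ) ≤ k := by positivity
      linarith
    · exact h

open Classical in
theorem aux_sum_zero' (n : ℕ) (f : Finset α → ℚ)
    (hf : ∀ C : Finset α, C.card = n + 1 → ∑ B ∈ C.powersetCard n, f B = 0)
    (A : Finset α) :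
    ∀ (m : ℕ) (S : Finset α), A.card + m = n → Disjoint A S → n + 1 ≤ S.card →
      ∑ B ∈ S.powersetCard m, f (A ∪ B) = 0 := by
  induction A using Finset.induction_on with
  | empty =>
    intro m S hm _ hS
    simp only [Finset.card_empty, zero_add] at hm
    subst hm
    obtain ⟨k, hk⟩ := Nat.exists_eq_add_of_le hS
    simpa using aux_sum_zero m f hf k S hk
  | insert a A ha ih =>
    intro m S hm hd hS
    rw [Finset.card_insert_of_notMem ha] at hm
    rw [Finset.disjoint_insert_left] at hd
    have h1 := ih (m + 1) S (by omega) hd.2 hS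
    have h2 := ih (m + 1) (insert a S) (by omega)
      (by rw [Finset.disjoint_insert_right]; exact ⟨ha, hd.2⟩)
      (by rw [Finset.card_insert_of_notMem hd.1]; omega)
    rw [Finset.powersetCard_succ_insert hd.1, Finset.sum_union, h1, zero_add,
      Finset.sum_image] at h2
    · rw [← h2]
      apply Finset.sum_congr rfl
      intro B _
      congr 1
      ext x; simp
    · intro B hB B' hB' hBB
      simp only [Finset.mem_coe,
        Finset.mem_powersetCard] at hB hB'
      have e := congrArg (fun s => Finset.erase s a) hBB
      simpa [Finset.erase_insert (fun h => hd.1 (hB.1 h)),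
        Finset.erase_insert (fun h => hd.1 (hB'.1 h))] using e
    · rw [Finset.disjoint_left]
      intro B hB hB'
      rw [Finset.mem_powersetCard] at hB
      rw [Finset.mem_image] at hB'
      obtain ⟨B', _, rfl⟩ := hB'
      exact hd.1 (hB.1 (Finset.mem_insert_self _ _))

theorem aux_zero [Infinite α] (n : ℕ) (f : Finset α → ℚ)
    (hf : ∀ C : Finset α, C.card = n + 1 → ∑ B ∈ C.powersetCard n, f B = 0)
    (A : Finset α) (hA : A.card = n) : f A = 0 := by
  obtain ⟨T, hT, hc⟩ := (A.finite_toSet.infinite_compl).exists_subset_card_eq (n + 1)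
  have := aux_sum_zero' n f hf A 0 T (by omega) (by
    rw [Finset.disjoint_left]
    intro x hx hx'
    exact hT hx' hx) (by omega)
  simpa using this

open Classical in
theorem aux_finite (ar : I → ℕ) (rel : ∀ i, Set (Fin (ar i) → α)) (F : Finset α)
    (hF : FMonomorphic ar rel F) (n : ℕ) :
    Finite (Quot fun A B : {s : Finset α // s.card = n} =>
      IsoOn ar rel (↑A.1 : Set α) (↑B.1 : Set α)) := by
  apply Finite.of_injective (β := F.powerset)
    (fun q => ⟨q.out.1 ∩ F, Finset.mem_powerset.2 Finset.inter_subset_right⟩)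
  intro p q hpq
  have hpq' : p.out.1 ∩ F = q.out.1 ∩ F := congrArg Subtype.val hpq
  rw [← Quot.out_eq p, ← Quot.out_eq q]
  apply Quot.sound
  generalize p.out = A at *
  generalize q.out = B at *
  obtain ⟨A, hA⟩ := A
  obtain ⟨B, hB⟩ := B
  simp only at hpq' ⊢
  have hm : ∀ x ∈ F, (x ∈ A ↔ x ∈ B) := by
    intro x hx
    have := congrArg (fun s => x ∈ s) hpq'
    simpa [hx] using this
  have cA := Finset.card_sdiff_add_card_inter A F
  have cB := Finset.card_sdiff_add_card_inter B F
  rw [hpq'] at cA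
  obtain ⟨f, hid, ⟨hb, _⟩, hb', hp⟩ := hF (A \ F) (B \ F)
    (Finset.disjoint_coe.2 Finset.sdiff_disjoint)
    (Finset.disjoint_coe.2 Finset.sdiff_disjoint) (by omega)
  have hsub : (A : Set α) ⊆ (↑(A \ F) : Set α) ∪ ↑F := by
    intro x hx
    by_cases hxF : x ∈ F
    · exact Or.inr hxF
    · left; simp only [Finset.coe_sdiff]; exact ⟨hx, hxF⟩
  refine ⟨f, ⟨?_, hb'.injOn.mono hsub, ?_⟩, ?_⟩
  · intro x hx
    by_cases hxF : x ∈ F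
    · rw [hid x hxF]; exact (hm x hxF).1 hx
    · have := hb.mapsTo (x := x) (by simp only [Finset.coe_sdiff]; exact ⟨hx, hxF⟩)
      simp only [Finset.coe_sdiff] at this
      exact this.1
  · intro y hy
    by_cases hyF : y ∈ F
    · exact ⟨y, (hm y hyF).2 hy, hid y hyF⟩
    · obtain ⟨x, hx, rfl⟩ := hb.surjOn (a := y)
        (by simp only [Finset.coe_sdiff]; exact ⟨hy, hyF⟩)
      simp only [Finset.coe_sdiff] at hx
      exact ⟨x, hx.1, rfl⟩
  · intro i x hx
    exact hp i x fun j => hsub (hx j)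

/-- The type of isomorphism classes of `n`-element substructures. -/
abbrev AuxTy (ar : I → ℕ) (rel : ∀ i, Set (Fin (ar i) → α)) (n : ℕ) :=
  Quot fun A B : {s : Finset α // s.card = n} => IsoOn ar rel (↑A.1 : Set α) (↑B.1 : Set α)

/-- Extension of a function on isomorphism classes to all finite sets. -/
def auxExt (ar : I → ℕ) (rel : ∀ i, Set (Fin (ar i) → α)) (n : ℕ)
    (f : AuxTy ar rel n → ℚ) (B : Finset α) : ℚ :=
  if h : B.card = n then f (Quot.mk _ ⟨B, h⟩) else 0

open Classical in
theorem aux_inv (ar : I → ℕ) (rel : ∀ i, Set (Fin (ar i) → α)) (n : ℕ)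
    (f : AuxTy ar rel n → ℚ) (C D : Finset α) (h : IsoOn ar rel (↑C : Set α) ↑D) :
    ∑ B ∈ C.powersetCard n, auxExt ar rel n f B = ∑ B ∈ D.powersetCard n, auxExt ar rel n f B := by
  obtain ⟨g, hb, hp⟩ := h
  have hD : D = C.image g := by
    apply Finset.coe_injective
    rw [Finset.coe_image, hb.image_eq]
  have hcard : ∀ B ⊆ C, (B.image g).card = B.card := fun B hB =>
    Finset.card_image_of_injOn (hb.injOn.mono (Finset.coe_subset.2 hB))
  apply Finset.sum_bij (fun B _ => B.image g)
  · intro B hB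
    rw [Finset.mem_powersetCard] at hB ⊢
    exact ⟨hD ▸ Finset.image_subset_image hB.1, (hcard B hB.1).trans hB.2⟩
  · intro B hB B' hB' he
    rw [Finset.mem_powersetCard] at hB hB'
    apply Finset.coe_injective
    have he' := congrArg (fun s : Finset α => (s : Set α)) he
    simp only [Finset.coe_image] at he'
    exact (hb.injOn.image_eq_image_iff (Finset.coe_subset.2 hB.1)
      (Finset.coe_subset.2 hB'.1)).1 he'
  · intro B' hB'
    rw [Finset.mem_powersetCard, hD, Finset.subset_image_iff] at hB'
    obtain ⟨⟨B, hB, rfl⟩, hc⟩ := hB'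
    exact ⟨B, Finset.mem_powersetCard.2 ⟨Finset.coe_subset.1 hB, (hcard B hB) ▸ hc⟩, rfl⟩
  · intro B hB
    rw [Finset.mem_powersetCard] at hB
    have h2 := (hcard B hB.1).trans hB.2
    rw [auxExt, auxExt, dif_pos hB.2, dif_pos h2]
    congr 1
    apply Quot.sound
    refine ⟨g, ?_, fun i x hx => hp i x fun j => hB.1 (hx j)⟩
    simp only [Finset.coe_image]
    exact (hb.injOn.mono (Finset.coe_subset.2 hB.1)).bijOn_image

/-- The incidence map between functions on isomorphism classes. -/
def auxLin (ar : I → ℕ) (rel : ∀ i, Set (Fin (ar i) → α)) (n : ℕ) :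
    (AuxTy ar rel n → ℚ) →ₗ[ℚ] (AuxTy ar rel (n + 1) → ℚ) where
  toFun f := Quot.lift (fun C => ∑ B ∈ C.1.powersetCard n, auxExt ar rel n f B)
    (fun C D h => aux_inv ar rel n f C.1 D.1 h)
  map_add' f g := by
    funext q
    induction q using Quot.ind
    simp only [Pi.add_apply, ← Finset.sum_add_distrib]
    apply Finset.sum_congr rfl
    intro B _
    unfold auxExt
    split_ifs <;> simp
  map_smul' c f := by
    funext q
    induction q using Quot.ind
    simp only [Pi.smul_apply, RingHom.id_apply, Finset.smul_sum]
    apply Finset.sum_congr rfl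
    intro B _
    unfold auxExt
    split_ifs <;> simp

/-- **Claim.** If an infinite relational structure is almost monomorphic (that is,
`F`-monomorphic for some finite subset `F` of its domain), then its profile is
non-decreasing. -/
theorem profile_nondecreasing_of_almost_monomorphic [Infinite α]
    (ar : I → ℕ) (rel : ∀ i, Set (Fin (ar i) → α))
    (h : ∃ F : Finset α, FMonomorphic ar rel F) (n : ℕ) :
    profile ar rel n ≤ profile ar rel (n + 1) := by
  obtain ⟨F, hF⟩ := h
  have i1 := aux_finite ar rel F hF n
  have i2 := aux_finite ar rel F hF (n + 1)
  have hinj : Function.Injective (auxLin ar rel n) := by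
    rw [← LinearMap.ker_eq_bot, LinearMap.ker_eq_bot']
    intro f hf
    have h0 := aux_zero n (auxExt ar rel n f) (fun C hC => congrFun hf (Quot.mk _ ⟨C, hC⟩))
    funext q
    induction q using Quot.ind with
    | mk A =>
      have := h0 A.1 A.2
      rw [auxExt, dif_pos A.2] at this
      exact this
  have hle := LinearMap.finrank_le_finrank_of_injective hinj
  have := Fintype.ofFinite (AuxTy ar rel n)
  have := Fintype.ofFinite (AuxTy ar rel (n + 1))
  rw [Module.finrank_pi, Module.finrank_pi] at hle
  unfold profile
  rw [Cardinal.mk_fintype, Cardinal.mk_fintype]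
  exact_mod_cast hle
end

section
/- Let T be an infinite tournament. Then either (a) T is a lexicographical sum of acyclic tournaments indexed by a finite tournament, and the profile φ_T has polynomial growth (there exist a natural number k and positive reals a, b with a·n^k ≤ φ_T(n) ≤ b·n^k for all sufficiently large n); or (b) the growth of φ_T is at least exponential (there exists a real number c > 1 with φ_T(n) ≥ c^n for all sufficiently large n). -/
universe u

variable {V : Type u}

/-- The structures induced by the binary relation `ρ` on `A` and on `B` are isomorphic. -/
def BinIsoOn (ρ : V → V → Prop) (A B : Set V) : Prop :=
  ∃ f : V → V, Set.BijOn f A B ∧ ∀ a ∈ A, ∀ b ∈ A, (ρ a b ↔ ρ (f a) (f b))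

/-- The profile of a binary relational structure (graph, tournament, ...): the number of
isomorphism classes of structures induced on `n`-element subsets of the domain. -/
noncomputable def binProfile (ρ : V → V → Prop) (n : ℕ) : ℕ :=
  Nat.card (Quot fun A B : {s : Finset V // s.card = n} =>
    BinIsoOn ρ (↑A.1 : Set V) (↑B.1 : Set V))

/-- `ρ` is a tournament: irreflexive, and between two distinct vertices exactly one arc. -/
def IsTournament (ρ : V → V → Prop) : Prop :=
  (∀ x, ¬ ρ x x) ∧ ∀ x y : V, x ≠ y → (ρ x y ↔ ¬ ρ y x)

/-- The tournament `ρ` is a lexicographical sum of acyclic tournaments indexed by a finite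
tournament: there are a finite tournament `σ` on an index set `ι` and a fibration `c : V → ι`
such that arcs between distinct fibers are governed by `σ` and each fiber is acyclic
(transitive). -/
def IsFiniteLexSumOfAcyclic (ρ : V → V → Prop) : Prop :=
  ∃ (ι : Type) (σ : ι → ι → Prop) (c : V → ι), Finite ι ∧ IsTournament σ ∧
    (∀ x y : V, c x ≠ c y → (ρ x y ↔ σ (c x) (c y))) ∧
    (∀ x y z : V, c x = c y → c y = c z → ρ x y → ρ y z → ρ x z)

/-! ### Isomorphism classes and the counting lemma -/

/-- At least exponential growth of the profile. -/
def ExpG (ρ : V → V → Prop) : Prop :=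
  ∃ c : ℝ, 1 < c ∧ ∀ᶠ n : ℕ in Filter.atTop, c ^ n ≤ (binProfile ρ n : ℝ)

lemma binIso_refl (ρ : V → V → Prop) (A : Set V) : BinIsoOn ρ A A :=
  ⟨id, Set.bijOn_id A, fun _ _ _ _ => Iff.rfl⟩

lemma binIso_symm {ρ : V → V → Prop} [Nonempty V] {A B : Set V} (h : BinIsoOn ρ A B) :
    BinIsoOn ρ B A := by
  obtain ⟨f, hf, hr⟩ := h
  have hi := hf.invOn_invFunOn
  have hb : Set.BijOn (Function.invFunOn f A) B A := hi.symm.bijOn hf.surjOn.mapsTo_invFunOn hf.mapsTo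
  refine ⟨Function.invFunOn f A, hb, fun a ha b hb' => ?_⟩
  rw [hr _ (hb.mapsTo ha) _ (hb.mapsTo hb'), hi.2 ha, hi.2 hb']

lemma binIso_trans {ρ : V → V → Prop} {A B C : Set V} (h : BinIsoOn ρ A B)
    (h' : BinIsoOn ρ B C) : BinIsoOn ρ A C := by
  obtain ⟨f, hf, hr⟩ := h
  obtain ⟨g, hg, hs⟩ := h'
  refine ⟨g ∘ f, hg.comp hf, fun a ha b hb => ?_⟩
  rw [hr a ha b hb, hs _ (hf.mapsTo ha) _ (hf.mapsTo hb)]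
  rfl

/-- The type of isomorphism classes. -/
abbrev IsoCl (ρ : V → V → Prop) (n : ℕ) :=
  Quot fun A B : {s : Finset V // s.card = n} => BinIsoOn ρ (↑A.1 : Set V) (↑B.1 : Set V)

lemma isoCl_eq_iff {ρ : V → V → Prop} [Nonempty V] {n : ℕ} (A B : {s : Finset V // s.card = n}) :
    (Quot.mk _ A : IsoCl ρ n) = Quot.mk _ B ↔ BinIsoOn ρ (↑A.1 : Set V) (↑B.1 : Set V) := by
  rw [Quot.eq]
  have he : Equivalence (fun A B : {s : Finset V // s.card = n} =>
      BinIsoOn ρ (↑A.1 : Set V) (↑B.1 : Set V)) :=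
    ⟨fun A => binIso_refl ρ _, fun h => binIso_symm h, fun h h' => binIso_trans h h'⟩
  rw [he.eqvGen_iff]

lemma isoCl_finite (ρ : V → V → Prop) [Nonempty V] (n : ℕ) : Finite (IsoCl ρ n) := by
  classical
  have hen : ∀ A : {s : Finset V // s.card = n}, ∃ e : Fin n → V,
      Set.BijOn e Set.univ (↑A.1 : Set V) := by
    rintro ⟨A, hA⟩
    let g := (Finset.equivFinOfCardEq hA).symm
    refine ⟨fun i => (g i : V), fun i _ => (g i).2, fun i _ j _ h => ?_, fun x hx => ?_⟩
    · exact g.injective (Subtype.ext h)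
    · exact ⟨g.symm ⟨x, hx⟩, trivial, by simp⟩
  choose e he using hen
  let Φ : IsoCl ρ n → (Fin n → Fin n → Prop) := fun q i j => ρ (e q.out i) (e q.out j)
  refine Finite.of_injective Φ ?_
  intro q q' h
  rw [← Quot.out_eq q, ← Quot.out_eq q', isoCl_eq_iff]
  have h1 := he q.out
  have h2 := he q'.out
  by_cases hn : n = 0
  · subst hn
    have a1 : q.out.1 = ∅ := Finset.card_eq_zero.mp q.out.2
    have a2 : q'.out.1 = ∅ := Finset.card_eq_zero.mp q'.out.2
    rw [a1, a2]
    exact binIso_refl _ _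
  have : Nonempty (Fin n) := ⟨⟨0, Nat.pos_of_ne_zero hn⟩⟩
  have hi := h1.invOn_invFunOn
  have hb : Set.BijOn (Function.invFunOn (e q.out) Set.univ) (↑q.out.1 : Set V) Set.univ :=
    hi.symm.bijOn h1.surjOn.mapsTo_invFunOn h1.mapsTo
  refine ⟨e q'.out ∘ Function.invFunOn (e q.out) Set.univ, h2.comp hb, fun a ha b hb' => ?_⟩
  have := congrFun (congrFun h (Function.invFunOn (e q.out) Set.univ a))
    (Function.invFunOn (e q.out) Set.univ b)
  simp only [Φ] at this
  rw [hi.2 ha, hi.2 hb'] at this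
  rw [this]
  rfl

lemma expG_of_bound {ρ : V → V → Prop}
    (h : ∀ n : ℕ, 1 ≤ n → 2 ^ (n / 4) ≤ binProfile ρ n * n) : ExpG ρ := by
  refine ⟨(2 : ℝ) ^ ((1 : ℝ) / 8), Real.one_lt_rpow (by norm_num) (by norm_num), ?_⟩
  set c : ℝ := (2 : ℝ) ^ ((1 : ℝ) / 8) with hc
  have hc1 : 1 < c := Real.one_lt_rpow (by norm_num) (by norm_num)
  have hc8 : c ^ 8 = 2 := by
    rw [hc, ← Real.rpow_natCast, ← Real.rpow_mul (by norm_num)]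
    norm_num
  have ht : Filter.Tendsto (fun n : ℕ => (n : ℝ) ^ 1 / c ^ n) Filter.atTop (nhds 0) :=
    tendsto_pow_const_div_const_pow_of_one_lt 1 hc1
  have hev := ht.eventually (gt_mem_nhds (show (0 : ℝ) < 1 / 2 by norm_num))
  filter_upwards [hev, Filter.eventually_ge_atTop 1] with n hn hn1
  have hcn : 0 < c ^ n := by positivity
  have hn2 : 2 * (n : ℝ) ≤ c ^ n := by
    rw [pow_one, div_lt_iff₀ hcn] at hn
    linarith
  have hb := h n hn1
  have hb' : (2 : ℝ) ^ (n / 4) ≤ binProfile ρ n * n := by exact_mod_cast hb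
  have hpow : c ^ n * c ^ n ≤ 2 * (2 : ℝ) ^ (n / 4) := by
    rw [← hc8, ← pow_mul, ← pow_add, ← pow_add]
    apply pow_le_pow_right₀ hc1.le
    omega
  have hn0 : (0 : ℝ) < n := by exact_mod_cast hn1
  by_contra hlt
  push Not at hlt
  nlinarith

/-- Counting lemma: binary words can be decoded from the isomorphism type together with
one distinguished vertex. -/
theorem exp_of_codes [Nonempty V] (ρ : V → V → Prop) (e : ℕ → (ℕ → Bool) → ℕ → V)
    (hinj : ∀ n w, Set.InjOn (e n w) (Set.Iio n))
    (hdec : ∀ n w w' (τ : ℕ → ℕ), Set.BijOn τ (Set.Iio n) (Set.Iio n) → τ 0 = 0 →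
      (∀ s < n, ∀ t < n, (ρ (e n w s) (e n w t) ↔ ρ (e n w' (τ s)) (e n w' (τ t)))) →
      ∀ i, 4 * i + 4 ≤ n → w i = w' i) : ExpG ρ := by
  classical
  apply expG_of_bound
  intro n hn
  let k := n / 4
  let ex : (Fin k → Bool) → ℕ → Bool := fun w i => if h : i < k then w ⟨i, h⟩ else false
  have hA0 : ∀ w, ((Finset.range n).image (e n (ex w))).card = n := by
    intro w
    rw [Finset.card_image_of_injOn, Finset.card_range]
    simpa using hinj n (ex w)
  let A : (Fin k → Bool) → {s : Finset V // s.card = n} := fun w => ⟨_, hA0 w⟩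
  have hAm : ∀ w s, s < n → e n (ex w) s ∈ (↑(A w).1 : Set V) := by
    intro w s hs
    simp only [A, Finset.coe_image]
    exact ⟨s, by simpa using hs, rfl⟩
  have hAm' : ∀ w x, x ∈ (↑(A w).1 : Set V) → ∃ s < n, e n (ex w) s = x := by
    intro w x hx
    simpa [A] using hx
  have henc : ∀ B : {s : Finset V // s.card = n}, ∃ g : V → Fin n, Set.InjOn g (↑B.1 : Set V) := by
    rintro ⟨B, hB⟩
    let g := Finset.equivFinOfCardEq hB
    refine ⟨fun x => if h : x ∈ B then g ⟨x, h⟩ else ⟨0, hn⟩, fun x hx y hy h => ?_⟩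
    have hx' : x ∈ B := hx
    have hy' : y ∈ B := hy
    simp only [hx', hy', dif_pos] at h
    simpa using g.injective h
  choose enc henc using henc
  have hg : ∀ w, BinIsoOn ρ (↑(A w).1 : Set V) (↑((Quot.mk _ (A w) : IsoCl ρ n).out).1 : Set V) := by
    intro w
    rw [← isoCl_eq_iff, Quot.out_eq]
  choose g hgb hgr using hg
  let Φ : (Fin k → Bool) → IsoCl ρ n × Fin n := fun w =>
    (Quot.mk _ (A w), enc (Quot.mk _ (A w) : IsoCl ρ n).out (g w (e n (ex w) 0)))
  have hΦ : Function.Injective Φ := by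
    intro w w' h
    have h1 : (Quot.mk _ (A w) : IsoCl ρ n) = Quot.mk _ (A w') := congrArg Prod.fst h
    have h2 : enc (Quot.mk _ (A w) : IsoCl ρ n).out (g w (e n (ex w) 0)) =
      enc (Quot.mk _ (A w') : IsoCl ρ n).out (g w' (e n (ex w') 0)) := congrArg Prod.snd h
    have hb := hgb w
    have hb' := hgb w'
    rw [← h1] at h2 hb'
    have h3 : g w (e n (ex w) 0) = g w' (e n (ex w') 0) :=
      henc _ (hb.mapsTo (hAm w 0 hn)) (hb'.mapsTo (hAm w' 0 hn)) h2
    have hτ : ∀ s, ∃ t, (s < n → t < n ∧ g w' (e n (ex w') t) = g w (e n (ex w) s)) := by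
      intro s
      by_cases hs : s < n
      · obtain ⟨x, hx, hx'⟩ := hb'.surjOn (hb.mapsTo (hAm w s hs))
        obtain ⟨t, ht, rfl⟩ := hAm' w' x hx
        exact ⟨t, fun _ => ⟨ht, hx'⟩⟩
      · exact ⟨0, fun h => absurd h hs⟩
    choose τ hτ using hτ
    have hmaps : Set.MapsTo τ (Set.Iio n) (Set.Iio n) := fun s hs => (hτ s hs).1
    have hτinj : Set.InjOn τ (Set.Iio n) := by
      intro s hs t ht hst
      have a1 := (hτ s hs).2
      have a2 := (hτ t ht).2
      rw [← hst, a1] at a2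
      exact hinj n (ex w) hs ht (hb.injOn (hAm w s hs) (hAm w t ht) a2)
    have hτb : Set.BijOn τ (Set.Iio n) (Set.Iio n) :=
      by
      refine ⟨hmaps, hτinj, ?_⟩
      have := Finset.surjOn_of_injOn_of_card_le (s := Finset.range n) (t := Finset.range n) τ
        (by simpa using hmaps) (by simpa using hτinj) le_rfl
      simpa using this
    have hτ0 : τ 0 = 0 := by
      have a1 := (hτ 0 hn).2
      rw [h3] at a1
      exact hinj n (ex w') (hτ 0 hn).1 hn (hb'.injOn (hAm w' _ (hτ 0 hn).1) (hAm w' 0 hn) a1)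
    have := hdec n (ex w) (ex w') τ hτb hτ0 (fun s hs t ht => by
      rw [hgr w _ (hAm w s hs) _ (hAm w t ht), hgr w' _ (hAm w' _ (hτ s hs).1) _ (hAm w' _ (hτ t ht).1),
        (hτ s hs).2, (hτ t ht).2])
    funext i
    have hi := this i (by have := i.2; omega)
    simpa [ex] using hi
  have := isoCl_finite ρ n
  have hc := Nat.card_le_card_of_injective Φ hΦ
  rw [Nat.card_prod] at hc
  simpa [binProfile] using hc

lemma binProfile_rev (ρ : V → V → Prop) (n : ℕ) :
    binProfile (fun x y => ρ y x) n = binProfile ρ n := by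
  unfold binProfile
  have : (fun A B : {s : Finset V // s.card = n} =>
      BinIsoOn (fun x y => ρ y x) (↑A.1 : Set V) (↑B.1 : Set V)) =
    (fun A B : {s : Finset V // s.card = n} => BinIsoOn ρ (↑A.1 : Set V) (↑B.1 : Set V)) := by
    funext A B
    apply propext
    constructor
    · rintro ⟨f, hf, hr⟩
      exact ⟨f, hf, fun a ha b hb => hr b hb a ha⟩
    · rintro ⟨f, hf, hr⟩
      exact ⟨f, hf, fun a ha b hb => hr b hb a ha⟩
  rw [this]

lemma expG_rev {ρ : V → V → Prop} (h : ExpG (fun x y => ρ y x)) : ExpG ρ := by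
  unfold ExpG at *
  simpa only [binProfile_rev] using h

/-! ### Ramsey's theorem for pairs -/

theorem ramsey_pairs {K : Type*} [Finite K] (col : ℕ → ℕ → K) :
    ∃ g : ℕ → ℕ, StrictMono g ∧ ∃ k, ∀ i j, i < j → col (g i) (g j) = k := by
  have h1 : ∀ i, ∃ k, ∀ᶠ j in (Filter.hyperfilter ℕ : Filter ℕ), col i j = k := by
    intro i
    rw [← Ultrafilter.eventually_exists_iff]
    exact Filter.Eventually.of_forall fun j => ⟨_, rfl⟩
  have h2 : ∃ k, ∀ᶠ i in (Filter.hyperfilter ℕ : Filter ℕ),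
      ∀ᶠ j in (Filter.hyperfilter ℕ : Filter ℕ), col i j = k := by
    rw [← Ultrafilter.eventually_exists_iff]
    exact Filter.Eventually.of_forall h1
  obtain ⟨k, hk⟩ := h2
  obtain ⟨g, hg1, hg2⟩ := exists_seq_of_forall_finset_exists
    (fun i => ∀ᶠ j in (Filter.hyperfilter ℕ : Filter ℕ), col i j = k)
    (fun i j => i < j ∧ col i j = k) (by
      intro s hs
      have e1 : ∀ᶠ j in (Filter.hyperfilter ℕ : Filter ℕ), ∀ x ∈ s, col x j = k := by
        rw [Filter.eventually_all_finset]
        exact hs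
      have e2 : ∀ᶠ j in (Filter.hyperfilter ℕ : Filter ℕ), ∀ x ∈ s, x < j := by
        rw [Filter.eventually_all_finset]
        intro x _
        exact Nat.hyperfilter_le_atTop (Filter.eventually_gt_atTop x)
      obtain ⟨j, a, b, c⟩ := (hk.and (e1.and e2)).exists
      exact ⟨j, a, fun x hx => ⟨c x hx, b x hx⟩⟩)
  exact ⟨g, strictMono_nat_of_lt_succ fun n => (hg2 n (n + 1) (Nat.lt_succ_self n)).1, k,
    fun i j hij => (hg2 i j hij).2⟩

/-! ### Two chains separated by a vertex -/

lemma IsTournament.asymm {ρ : V → V → Prop} (hT : IsTournament ρ) {x y : V} (h : ρ x y) :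
    ¬ ρ y x := by
  by_cases hxy : x = y
  · subst hxy
    exact hT.1 x
  · exact (hT.2 x y hxy).1 h

lemma IsTournament.of_not {ρ : V → V → Prop} (hT : IsTournament ρ) {x y : V} (hxy : x ≠ y)
    (h : ¬ ρ x y) : ρ y x := by
  rw [hT.2 y x hxy.symm]
  exact h

lemma IsTournament.ne {ρ : V → V → Prop} (hT : IsTournament ρ) {x y : V} (h : ρ x y) : x ≠ y := by
  rintro rfl
  exact hT.1 x h

theorem exp_core {ρ : V → V → Prop} (hT : IsTournament ρ) (v : ℕ → V) (P : ℕ → V)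
    (Q : Bool → ℕ → V) (m1 m2 : Prop)
    (hvP : ∀ N, ∀ i < N, ρ (v N) (P i)) (hvQ : ∀ N, ∀ i < N, ∀ b, ρ (Q b i) (v N))
    (hP : ∀ i j, i < j → ((ρ (P i) (P j) ↔ m1) ∧ (ρ (P j) (P i) ↔ ¬ m1)))
    (hQ : ∀ i j, i < j → ∀ b b', ((ρ (Q b i) (Q b' j) ↔ m2) ∧ (ρ (Q b' j) (Q b i) ↔ ¬ m2)))
    (hd : ∀ i, (ρ (P i) (Q true i) ↔ ¬ ρ (P i) (Q false i))) : ExpG ρ := by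
  have : Nonempty V := ⟨v 0⟩
  let e : ℕ → (ℕ → Bool) → ℕ → V := fun n w s =>
    if s = 0 then v n else if s % 2 = 1 then P (s / 2) else Q (w (s / 2 - 1)) (s / 2 - 1)
  have e0 : ∀ n w, e n w 0 = v n := fun n w => by simp [e]
  have eo : ∀ n w s, s % 2 = 1 → e n w s = P (s / 2) := by
    intro n w s hs
    have : s ≠ 0 := by omega
    simp [e, hs, this]
  have ee : ∀ n w s, s ≠ 0 → s % 2 = 0 → e n w s = Q (w (s / 2 - 1)) (s / 2 - 1) := by
    intro n w s hs hs'
    simp [e, hs, hs']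
  -- parity is detected by the distinguished vertex
  have hpar : ∀ n w s, s ≠ 0 → s < n → (ρ (v n) (e n w s) ↔ s % 2 = 1) := by
    intro n w s hs hsn
    rcases Nat.mod_two_eq_zero_or_one s with h | h
    · rw [ee n w s hs h]
      have := hT.asymm (hvQ n (s / 2 - 1) (by omega) (w (s / 2 - 1)))
      simp [this, h]
    · rw [eo n w s h]
      simp [hvP n (s / 2) (by omega), h]
  have hne : ∀ n w s, s ≠ 0 → s < n → e n w s ≠ v n := by
    intro n w s hs hsn
    rcases Nat.mod_two_eq_zero_or_one s with h | h
    · rw [ee n w s hs h]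
      exact hT.ne (hvQ n (s / 2 - 1) (by omega) _)
    · rw [eo n w s h]
      exact (hT.ne (hvP n (s / 2) (by omega))).symm
  have hmono : ∀ n w s t, s ≠ 0 → s < t → s % 2 = t % 2 →
      ((ρ (e n w s) (e n w t) ↔ (if s % 2 = 1 then m1 else m2)) ∧
       (ρ (e n w t) (e n w s) ↔ ¬ (if s % 2 = 1 then m1 else m2))) := by
    intro n w s t hs hst hp
    rcases Nat.mod_two_eq_zero_or_one s with h | h
    · rw [ee n w s hs h, ee n w t (by omega) (by omega)]
      have := hQ (s / 2 - 1) (t / 2 - 1) (by omega) (w (s / 2 - 1)) (w (t / 2 - 1))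
      simpa [h] using this
    · rw [eo n w s h, eo n w t (by omega)]
      have := hP (s / 2) (t / 2) (by omega)
      simpa [h] using this
  apply exp_of_codes ρ e
  · intro n w
    have key : ∀ s t, s < t → s < n → t < n → e n w s ≠ e n w t := by
      intro s t hst hs ht heq
      by_cases h0 : s = 0
      · subst h0
        rw [e0] at heq
        exact hne n w t (by omega) ht heq.symm
      · by_cases hp : s % 2 = t % 2
        · obtain ⟨a, b⟩ := hmono n w s t h0 hst hp
          rw [heq] at a b
          tauto
        · have a := hpar n w s h0 hs
          have b := hpar n w t (by omega) ht
          rw [heq, b] at a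
          omega
    intro s hs t ht heq
    by_contra hcon
    rcases lt_or_gt_of_ne hcon with h | h
    · exact key s t h hs ht heq
    · exact key t s h ht hs heq.symm
  · intro n w w' τ hτ hτ0 hiso i hi
    have hτne : ∀ s, s ≠ 0 → s < n → τ s ≠ 0 := by
      intro s hs hsn h
      exact hs (hτ.injOn hsn (show 0 < n by omega) (by rw [h, hτ0]))
    have hpt : ∀ s, s ≠ 0 → s < n → τ s % 2 = s % 2 := by
      intro s hs hsn
      have a := hpar n w s hs hsn
      have b := hpar n w' (τ s) (hτne s hs hsn) (hτ.mapsTo hsn)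
      have c := hiso 0 (by omega) s hsn
      rw [hτ0, e0, e0, a, b] at c
      omega
    have hid : ∀ s, s < n → τ s = s := by
      intro s
      induction s using Nat.strong_induction_on with
      | _ s ih =>
        intro hsn
        by_cases hs0 : s = 0
        · rw [hs0, hτ0]
        have hge : s ≤ τ s := by
          by_contra hlt
          push Not at hlt
          have := ih (τ s) hlt (by omega)
          have := hτ.injOn (show τ s < n by omega) hsn this
          omega
        by_contra hneq
        obtain ⟨t, htn, ht⟩ := hτ.surjOn (show s ∈ Set.Iio n from hsn)
        have htn' : t < n := htn
        have hts : s < t := by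
          by_contra hle
          push Not at hle
          rcases Nat.lt_or_eq_of_le hle with h | h
          · have := ih t h htn'
            omega
          · subst h
            exact hneq ht
        have p1 := hpt t (by omega) htn'
        have p2 := hpt s hs0 hsn
        have a := hmono n w s t hs0 hts (by omega)
        have b := hmono n w' s (τ s) hs0 (by omega) (by omega)
        have c := hiso s hsn t htn'
        rw [ht, a.1, b.2] at c
        tauto
    have c := hiso (2 * i + 1) (by omega) (2 * i + 2) (by omega)
    rw [hid _ (by omega), hid _ (by omega), eo n w _ (by omega), eo n w' _ (by omega),
      ee n w _ (by omega) (by omega), ee n w' _ (by omega) (by omega)] at c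
    have q1 : (2 * i + 1) / 2 = i := by omega
    have q2 : (2 * i + 2) / 2 - 1 = i := by omega
    rw [q1, q2] at c
    have d := hd i
    cases h1 : w i <;> cases h2 : w' i <;> simp only [h1, h2] at c <;> first | rfl | tauto

theorem exp_sep1 {ρ : V → V → Prop} (hT : IsTournament ρ) (p q : ℕ → V) (m1 m2 α β : Prop)
    (hsep : ∀ N, ∃ v, ∀ i < N, ρ v (p i) ∧ ρ (q i) v)
    (hp : ∀ i j, i < j → ((ρ (p i) (p j) ↔ m1) ∧ (ρ (p j) (p i) ↔ ¬ m1)))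
    (hq : ∀ i j, i < j → ((ρ (q i) (q j) ↔ m2) ∧ (ρ (q j) (q i) ↔ ¬ m2)))
    (h1 : ∀ i j, i < j → (ρ (p i) (q j) ↔ α)) (h2 : ∀ i j, i < j → (ρ (p j) (q i) ↔ β))
    (hne : ¬ (α ↔ β)) : ExpG ρ := by
  choose v hv using hsep
  refine exp_core hT (fun N => v (4 * N + 4)) (fun i => p (4 * i + 1))
    (fun b i => q (4 * i + (if b then 2 else 0))) m1 m2 ?_ ?_ ?_ ?_ ?_
  · intro N i hi
    exact (hv _ _ (by omega)).1
  · intro N i hi b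
    exact (hv _ _ (by split <;> omega)).2
  · intro i j hij
    exact hp _ _ (by omega)
  · intro i j hij b b'
    exact hq _ _ (by split <;> split <;> omega)
  · intro i
    have a := h1 (4 * i + 1) (4 * i + 2) (by omega)
    have b := h2 (4 * i) (4 * i + 1) (by omega)
    simp only [if_true, Bool.false_eq_true, if_false, Nat.add_zero]
    tauto

theorem exp_sep2 {ρ : V → V → Prop} (hT : IsTournament ρ) (p q : ℕ → V) (m1 m2 α γ : Prop)
    (hsep : ∀ N, ∃ v, ∀ i < N, ρ v (p i) ∧ ρ (q i) v)
    (hp : ∀ i j, i < j → ((ρ (p i) (p j) ↔ m1) ∧ (ρ (p j) (p i) ↔ ¬ m1)))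
    (hq : ∀ i j, i < j → ((ρ (q i) (q j) ↔ m2) ∧ (ρ (q j) (q i) ↔ ¬ m2)))
    (h1 : ∀ i j, i < j → (ρ (p i) (q j) ↔ α)) (h2 : ∀ i, (ρ (p i) (q i) ↔ γ))
    (hne : ¬ (α ↔ γ)) : ExpG ρ := by
  choose v hv using hsep
  refine exp_core hT (fun N => v (2 * N + 4)) (fun i => p (2 * i))
    (fun b i => q (2 * i + (if b then 1 else 0))) m1 m2 ?_ ?_ ?_ ?_ ?_
  · intro N i hi
    exact (hv _ _ (by omega)).1
  · intro N i hi b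
    exact (hv _ _ (by split <;> omega)).2
  · intro i j hij
    exact hp _ _ (by omega)
  · intro i j hij b b'
    exact hq _ _ (by split <;> split <;> omega)
  · intro i
    have a := h1 (2 * i) (2 * i + 1) (by omega)
    have b := h2 (2 * i)
    simp only [if_true, Bool.false_eq_true, if_false, Nat.add_zero]
    tauto

/-! ### Ordinal sums of 3-cycles -/

theorem exp_tri {ρ : V → V → Prop} (hT : IsTournament ρ) (y : Fin 3 → ℕ → V)
    (hf : ∀ i j, i < j → ∀ p q, ρ (y p i) (y q j))
    (h01 : ∀ i, ρ (y 0 i) (y 1 i)) (h12 : ∀ i, ρ (y 1 i) (y 2 i)) (h20 : ∀ i, ρ (y 2 i) (y 0 i)) :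
    ExpG ρ := by
  classical
  have : Nonempty V := ⟨y 0 0⟩
  let tp : (ℕ → Bool) → ℕ → Fin 3 := fun w s =>
    if w (s / 4) then ![0, 0, 1, 2] ⟨s % 4, Nat.mod_lt _ (by norm_num)⟩
    else ![0, 1, 2, 0] ⟨s % 4, Nat.mod_lt _ (by norm_num)⟩
  let ix : (ℕ → Bool) → ℕ → ℕ := fun w s => 2 * (s / 4) +
    if w (s / 4) then (if s % 4 = 0 then 0 else 1) else (if s % 4 = 3 then 1 else 0)
  let e : (ℕ → Bool) → ℕ → V := fun w s => y (tp w s) (ix w s)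
  have hix : ∀ w s, ix w s = 2 * (s / 4) ∨ ix w s = 2 * (s / 4) + 1 := by
    intro w s
    simp only [ix]
    split_ifs <;> simp
  have hlt : ∀ w s t, s / 4 < t / 4 → ρ (e w s) (e w t) := by
    intro w s t hst
    apply hf
    have := hix w s
    have := hix w t
    omega
  have ht0 : ∀ w i, w i = true → e w (4 * i) = y 0 (2 * i) := by
    intro w i h
    simp [e, tp, ix, h]
  have d1 : ∀ i, (4 * i + 1) / 4 = i := fun i => by omega
  have d2 : ∀ i, (4 * i + 2) / 4 = i := fun i => by omega
  have d3 : ∀ i, (4 * i + 3) / 4 = i := fun i => by omega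
  have m1 : ∀ i, (4 * i + 1) % 4 = 1 := fun i => by omega
  have m2 : ∀ i, (4 * i + 2) % 4 = 2 := fun i => by omega
  have m3 : ∀ i, (4 * i + 3) % 4 = 3 := fun i => by omega
  have ht1 : ∀ w i, w i = true → e w (4 * i + 1) = y 0 (2 * i + 1) := by
    intro w i h
    simp [e, tp, ix, h, d1, m1]
  have ht2 : ∀ w i, w i = true → e w (4 * i + 2) = y 1 (2 * i + 1) := by
    intro w i h
    simp [e, tp, ix, h, d2, m2]
  have ht3 : ∀ w i, w i = true → e w (4 * i + 3) = y 2 (2 * i + 1) := by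
    intro w i h
    simp [e, tp, ix, h, d3, m3]
  have hf0 : ∀ w i, w i = false → e w (4 * i) = y 0 (2 * i) := by
    intro w i h
    simp [e, tp, ix, h]
  have hf1 : ∀ w i, w i = false → e w (4 * i + 1) = y 1 (2 * i) := by
    intro w i h
    simp [e, tp, ix, h, d1, m1]
  have hf2 : ∀ w i, w i = false → e w (4 * i + 2) = y 2 (2 * i) := by
    intro w i h
    simp [e, tp, ix, h, d2, m2]
  have hf3 : ∀ w i, w i = false → e w (4 * i + 3) = y 0 (2 * i + 1) := by
    intro w i h
    simp [e, tp, ix, h, d3, m3]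
  have h4 : ∀ s, s = 4 * (s / 4) ∨ s = 4 * (s / 4) + 1 ∨ s = 4 * (s / 4) + 2 ∨
      s = 4 * (s / 4) + 3 := fun s => by omega
  -- within a block all vertices are distinct
  have hblk : ∀ w s t, s / 4 = t / 4 → s < t → ρ (e w s) (e w t) ∨ ρ (e w t) (e w s) := by
    intro w s t hst hlt'
    have hs := h4 s
    have ht := h4 t
    rw [← hst] at ht
    generalize s / 4 = i at hs ht
    have F := fun p q => hf (2 * i) (2 * i + 1) (by omega) p q
    cases hw : w i
    · rcases hs with hs | hs | hs | hs <;> rcases ht with ht | ht | ht | ht <;>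
        first
        | (exfalso; omega)
        | (rw [hs, ht]; simp only [hf0 w i hw, hf1 w i hw, hf2 w i hw, hf3 w i hw, F, h01, h12, h20,
            true_or, or_true])
    · rcases hs with hs | hs | hs | hs <;> rcases ht with ht | ht | ht | ht <;>
        first
        | (exfalso; omega)
        | (rw [hs, ht]; simp only [ht0 w i hw, ht1 w i hw, ht2 w i hw, ht3 w i hw, F, h01, h12, h20,
            true_or, or_true])
  -- the co-score
  let cs : ℕ → (ℕ → Bool) → ℕ → ℕ := fun n w s =>
    ((Finset.range n).filter (fun t => ¬ ρ (e w s) (e w t))).card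
  have hcs : ∀ n w i, 4 * i + 4 ≤ n → (w i = true ↔ ∃ s < n, cs n w s = 4 * i + 1) := by
    intro n w i hi
    constructor
    · intro hw
      refine ⟨4 * i, by omega, ?_⟩
      have : (Finset.range n).filter (fun t => ¬ ρ (e w (4 * i)) (e w t)) =
          Finset.range (4 * i + 1) := by
        ext t
        simp only [Finset.mem_filter, Finset.mem_range]
        constructor
        · rintro ⟨htn, ht⟩
          by_contra hcon
          push Not at hcon
          apply ht
          by_cases hb : i < t / 4
          · exact hlt w _ _ (by omega)
          · have F := fun q => hf (2 * i) (2 * i + 1) (by omega) 0 q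
            have : t = 4 * i + 1 ∨ t = 4 * i + 2 ∨ t = 4 * i + 3 := by omega
            rcases this with rfl | rfl | rfl
            · rw [ht0 w i hw, ht1 w i hw]; exact F _
            · rw [ht0 w i hw, ht2 w i hw]; exact F _
            · rw [ht0 w i hw, ht3 w i hw]; exact F _
        · intro ht
          refine ⟨by omega, ?_⟩
          by_cases hb : t = 4 * i
          · subst hb
            exact hT.1 _
          · exact hT.asymm (hlt w _ _ (by omega))
      simp only [cs, this, Finset.card_range]
    · rintro ⟨s, hsn, hs⟩
      by_contra hw
      have hw : w i = false := by simpa using hw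
      have low : Finset.range (4 * (s / 4)) ⊆
          (Finset.range n).filter (fun t => ¬ ρ (e w s) (e w t)) := by
        intro t ht
        simp only [Finset.mem_filter, Finset.mem_range] at ht ⊢
        exact ⟨by omega, hT.asymm (hlt w _ _ (by omega))⟩
      rcases lt_trichotomy (s / 4) i with h | h | h
      · have up : (Finset.range n).filter (fun t => ¬ ρ (e w s) (e w t)) ⊆
            Finset.range (4 * i) := by
          intro t ht
          simp only [Finset.mem_filter, Finset.mem_range] at ht ⊢
          by_contra hcon
          exact ht.2 (hlt w _ _ (by omega))
        have := Finset.card_le_card up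
        rw [Finset.card_range] at this
        simp only [cs] at hs
        omega
      · have hex : ∃ t, t < n ∧ 4 * i ≤ t ∧ t ≠ s ∧ ρ (e w t) (e w s) := by
          have hs4 := h4 s
          rw [h] at hs4
          rcases hs4 with hs4 | hs4 | hs4 | hs4
          · refine ⟨4 * i + 2, by omega, by omega, by omega, ?_⟩
            rw [hs4, hf2 w i hw, hf0 w i hw]
            exact h20 _
          · refine ⟨4 * i, by omega, by omega, by omega, ?_⟩
            rw [hs4, hf1 w i hw, hf0 w i hw]
            exact h01 _
          · refine ⟨4 * i + 1, by omega, by omega, by omega, ?_⟩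
            rw [hs4, hf1 w i hw, hf2 w i hw]
            exact h12 _
          · refine ⟨4 * i, by omega, by omega, by omega, ?_⟩
            rw [hs4, hf3 w i hw, hf0 w i hw]
            exact hf _ _ (by omega) _ _
        obtain ⟨t, htn, ht4, hts, htr⟩ := hex
        have low' : insert t (insert s (Finset.range (4 * i))) ⊆
            (Finset.range n).filter (fun t => ¬ ρ (e w s) (e w t)) := by
          intro u hu
          rw [Finset.mem_insert, Finset.mem_insert] at hu
          rcases hu with rfl | rfl | hu
          · simp only [Finset.mem_filter, Finset.mem_range]
            exact ⟨htn, hT.asymm htr⟩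
          · simp only [Finset.mem_filter, Finset.mem_range]
            exact ⟨hsn, hT.1 _⟩
          · exact low (by rw [h]; exact hu)
        have hc := Finset.card_le_card low'
        rw [Finset.card_insert_of_notMem, Finset.card_insert_of_notMem, Finset.card_range] at hc
        · simp only [cs] at hs
          omega
        · simp only [Finset.mem_range]
          omega
        · simp only [Finset.mem_insert, Finset.mem_range]
          omega
      · have hc := Finset.card_le_card low
        rw [Finset.card_range] at hc
        simp only [cs] at hs
        omega
  apply exp_of_codes ρ (fun _ => e)
  · intro n w
    have key : ∀ s t, s < t → e w s ≠ e w t := by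
      intro s t hst
      by_cases hb : s / 4 = t / 4
      · rcases hblk w s t hb hst with h | h
        · exact hT.ne h
        · exact (hT.ne h).symm
      · exact hT.ne (hlt w s t (by omega))
    intro s hs t ht heq
    by_contra hcon
    rcases lt_or_gt_of_ne hcon with h | h
    · exact key s t h heq
    · exact key t s h heq.symm
  · intro n w w' τ hτ _ hiso i hi
    have hcseq : ∀ s < n, cs n w s = cs n w' (τ s) := by
      intro s hs
      refine Finset.card_nbij τ ?_ ?_ ?_
      · intro t ht
        simp only [Finset.coe_filter, Finset.mem_range, Set.mem_ofPred_eq] at ht ⊢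
        exact ⟨hτ.mapsTo ht.1, by rw [← hiso s hs t ht.1]; exact ht.2⟩
      · intro t ht u hu h
        simp only [Finset.coe_filter, Finset.mem_range, Set.mem_ofPred_eq] at ht hu
        exact hτ.injOn ht.1 hu.1 h
      · intro u hu
        simp only [Finset.coe_filter, Finset.mem_range, Set.mem_ofPred_eq] at hu
        obtain ⟨t, ht, rfl⟩ := hτ.surjOn (show u ∈ Set.Iio n from hu.1)
        refine ⟨t, ?_, rfl⟩
        simp only [Finset.coe_filter, Finset.mem_range, Set.mem_ofPred_eq]
        exact ⟨ht, by rw [hiso s hs t ht]; exact hu.2⟩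
    have hiff : w i = true ↔ w' i = true := by
      rw [hcs n w i hi, hcs n w' i hi]
      constructor
      · rintro ⟨s, hs, h⟩
        exact ⟨τ s, hτ.mapsTo hs, by rw [← hcseq s hs]; exact h⟩
      · rintro ⟨u, hu, h⟩
        obtain ⟨s, hs, rfl⟩ := hτ.surjOn (show u ∈ Set.Iio n from hu)
        exact ⟨s, hs, by rw [hcseq s hs]; exact h⟩
    exact Bool.eq_iff_iff.mpr hiff

/-! ### Homogeneous families of sequences -/

lemma hom_sep {ρ : V → V → Prop} {K : Type*} {y : K → ℕ → V} {R S : K → K → Prop}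
    (hR : ∀ p q i j, i < j → (ρ (y p i) (y q j) ↔ R p q))
    (hS : ∀ p q i j, i < j → (ρ (y q j) (y p i) ↔ S p q)) (p q r : K)
    (hsep : (R r p ∧ S r q) ∨ (S p r ∧ R q r)) :
    ∀ N, ∃ v, ∀ i < N, ρ v (y p (i + 1)) ∧ ρ (y q (i + 1)) v := by
  intro N
  rcases hsep with h | h
  · refine ⟨y r 0, fun i _ => ⟨(hR _ _ _ _ (by omega)).2 h.1, (hS _ _ _ _ (by omega)).2 h.2⟩⟩
  · refine ⟨y r (N + 1), fun i hi => ⟨(hS _ _ _ _ (by omega)).2 h.1, (hR _ _ _ _ (by omega)).2 h.2⟩⟩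

lemma hom_exp1 {ρ : V → V → Prop} (hT : IsTournament ρ) {K : Type*} {y : K → ℕ → V}
    {R S : K → K → Prop}
    (hR : ∀ p q i j, i < j → (ρ (y p i) (y q j) ↔ R p q))
    (hS : ∀ p q i j, i < j → (ρ (y q j) (y p i) ↔ S p q)) (p q r : K)
    (hp : S p p ↔ ¬ R p p) (hq : S q q ↔ ¬ R q q)
    (hsep : (R r p ∧ S r q) ∨ (S p r ∧ R q r)) (hne : ¬ (R p q ↔ S q p)) : ExpG ρ := by
  refine exp_sep1 hT (fun i => y p (i + 1)) (fun i => y q (i + 1)) (R p p) (R q q) (R p q) (S q p)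
    (hom_sep hR hS p q r hsep) ?_ ?_ ?_ ?_ hne
  · intro i j hij
    exact ⟨hR _ _ _ _ (by omega), by rw [hS _ _ _ _ (by omega), hp]⟩
  · intro i j hij
    exact ⟨hR _ _ _ _ (by omega), by rw [hS _ _ _ _ (by omega), hq]⟩
  · intro i j hij
    exact hR _ _ _ _ (by omega)
  · intro i j hij
    exact hS _ _ _ _ (by omega)

lemma hom_exp2 {ρ : V → V → Prop} (hT : IsTournament ρ) {K : Type*} {y : K → ℕ → V}
    {R S : K → K → Prop}
    (hR : ∀ p q i j, i < j → (ρ (y p i) (y q j) ↔ R p q))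
    (hS : ∀ p q i j, i < j → (ρ (y q j) (y p i) ↔ S p q)) (p q r : K)
    (hp : S p p ↔ ¬ R p p) (hq : S q q ↔ ¬ R q q)
    (hsep : (R r p ∧ S r q) ∨ (S p r ∧ R q r)) (hg : ∀ i, ρ (y p i) (y q i)) (hne : ¬ R p q) :
    ExpG ρ := by
  refine exp_sep2 hT (fun i => y p (i + 1)) (fun i => y q (i + 1)) (R p p) (R q q) (R p q) True
    (hom_sep hR hS p q r hsep) ?_ ?_ ?_ ?_ (by tauto)
  · intro i j hij
    exact ⟨hR _ _ _ _ (by omega), by rw [hS _ _ _ _ (by omega), hp]⟩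
  · intro i j hij
    exact ⟨hR _ _ _ _ (by omega), by rw [hS _ _ _ _ (by omega), hq]⟩
  · intro i j hij
    exact hR _ _ _ _ (by omega)
  · intro i
    simp [hg]

theorem exp_main4 {ρ : V → V → Prop} (hT : IsTournament ρ) (a b c x : ℕ → V)
    (hax : ∀ i j, i ≤ j → ρ (a i) (x j)) (hbx : ∀ i j, i ≤ j → ρ (b i) (x j))
    (hxa : ∀ i j, i < j → ρ (x i) (a j)) (hxb : ∀ i j, i < j → ρ (x i) (b j))
    (hab : ∀ i, ρ (a i) (b i)) (hbc : ∀ i, ρ (b i) (c i)) (hca : ∀ i, ρ (c i) (a i)) :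
    ExpG ρ := by
  classical
  by_contra hexp
  let Y : Fin 4 → ℕ → V := ![a, b, c, x]
  obtain ⟨g, hg, k, hk⟩ := ramsey_pairs (K := Fin 4 → Fin 4 → Prop × Prop)
    (fun i j p q => (ρ (Y p i) (Y q j), ρ (Y q j) (Y p i)))
  let y : Fin 4 → ℕ → V := fun p i => Y p (g i)
  let R : Fin 4 → Fin 4 → Prop := fun p q => (k p q).1
  let S : Fin 4 → Fin 4 → Prop := fun p q => (k p q).2
  have hR : ∀ p q i j, i < j → (ρ (y p i) (y q j) ↔ R p q) := by
    intro p q i j hij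
    have := congrArg Prod.fst (congrFun (congrFun (hk i j hij) p) q)
    exact iff_of_eq this
  have hS : ∀ p q i j, i < j → (ρ (y q j) (y p i) ↔ S p q) := by
    intro p q i j hij
    have := congrArg Prod.snd (congrFun (congrFun (hk i j hij) p) q)
    exact iff_of_eq this
  have gle : ∀ i, g i ≤ g i := fun i => le_rfl
  have y0x : ∀ i j, i ≤ j → ρ (y 0 i) (y 3 j) := fun i j h => hax _ _ (hg.monotone h)
  have y1x : ∀ i j, i ≤ j → ρ (y 1 i) (y 3 j) := fun i j h => hbx _ _ (hg.monotone h)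
  have yx0 : ∀ i j, i < j → ρ (y 3 i) (y 0 j) := fun i j h => hxa _ _ (hg h)
  have yx1 : ∀ i j, i < j → ρ (y 3 i) (y 1 j) := fun i j h => hxb _ _ (hg h)
  have y01 : ∀ i, ρ (y 0 i) (y 1 i) := fun i => hab _
  have y12 : ∀ i, ρ (y 1 i) (y 2 i) := fun i => hbc _
  have y20 : ∀ i, ρ (y 2 i) (y 0 i) := fun i => hca _
  have notboth : ∀ p q, R p q → ¬ S p q := by
    intro p q h h'
    rw [← hR p q 0 1 (by omega)] at h
    rw [← hS p q 0 1 (by omega)] at h'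
    exact hT.asymm h h'
  have heq : ∀ p q, ¬ R p q → ¬ S p q → ∀ i j, i < j → y p i = y q j := by
    intro p q h h' i j hij
    by_contra hne
    rw [← hR p q i j hij] at h
    rw [← hS p q i j hij] at h'
    exact h' (hT.of_not hne h)
  -- the sequences of type 0, 1, 3 are not constant
  have hnc : ∀ p : Fin 4, p ≠ 2 → ∀ i j, i < j → y p i ≠ y p j := by
    intro p hp i j hij h
    fin_cases p
    · have h1 := y0x i i le_rfl
      have h2 := yx0 i j hij
      simp only [Fin.zero_eta] at h
      rw [← h] at h2
      exact hT.asymm h1 h2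
    · have h1 := y1x i i le_rfl
      have h2 := yx1 i j hij
      simp only [Fin.mk_one] at h
      rw [← h] at h2
      exact hT.asymm h1 h2
    · exact hp rfl
    · have h1 := yx0 i j hij
      have h2 := y0x j j le_rfl
      have h : y 3 i = y 3 j := h
      rw [← h] at h2
      exact hT.asymm h1 h2
  have htri0 : ∀ p q, ¬ (p = 2 ∧ q = 2) → (S p q ↔ ¬ R p q) := by
    intro p q hpq
    constructor
    · intro h h'
      exact notboth p q h' h
    · intro h
      by_contra h'
      have E := heq p q h h'
      by_cases hq : q = 2
      · have hp : p ≠ 2 := fun hp => hpq ⟨hp, hq⟩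
        exact hnc p hp 0 1 (by omega) ((E 0 2 (by omega)).trans (E 1 2 (by omega)).symm)
      · exact hnc q hq 1 2 (by omega) ((E 0 1 (by omega)).symm.trans (E 0 2 (by omega)))
  have R03 : R 0 3 := (hR 0 3 0 1 (by omega)).1 (y0x 0 1 (by omega))
  have R13 : R 1 3 := (hR 1 3 0 1 (by omega)).1 (y1x 0 1 (by omega))
  have R30 : R 3 0 := (hR 3 0 0 1 (by omega)).1 (yx0 0 1 (by omega))
  have R31 : R 3 1 := (hR 3 1 0 1 (by omega)).1 (yx1 0 1 (by omega))
  have t00 := htri0 0 0 (by decide)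
  have t11 := htri0 1 1 (by decide)
  have t33 := htri0 3 3 (by decide)
  -- types 0, 1 and 3 are not separated
  have n03 : ∀ r, ¬ ((R r 0 ∧ S r 3) ∨ (S 0 r ∧ R 3 r)) := fun r h =>
    hexp (hom_exp1 hT hR hS 0 3 r t00 t33 h fun h' => notboth 3 0 R30 (h'.1 R03))
  have n30 : ∀ r, ¬ ((R r 3 ∧ S r 0) ∨ (S 3 r ∧ R 0 r)) := fun r h =>
    hexp (hom_exp1 hT hR hS 3 0 r t33 t00 h fun h' => notboth 0 3 R03 (h'.1 R30))
  have n13 : ∀ r, ¬ ((R r 1 ∧ S r 3) ∨ (S 1 r ∧ R 3 r)) := fun r h =>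
    hexp (hom_exp1 hT hR hS 1 3 r t11 t33 h fun h' => notboth 3 1 R31 (h'.1 R13))
  have n31 : ∀ r, ¬ ((R r 3 ∧ S r 1) ∨ (S 3 r ∧ R 1 r)) := fun r h =>
    hexp (hom_exp1 hT hR hS 3 1 r t33 t11 h fun h' => notboth 1 3 R13 (h'.1 R31))
  have t23 := htri0 2 3 (by decide)
  have t20 := htri0 2 0 (by decide)
  have t21 := htri0 2 1 (by decide)
  have t02 := htri0 0 2 (by decide)
  have t12 := htri0 1 2 (by decide)
  have t32 := htri0 3 2 (by decide)
  have t01 := htri0 0 1 (by decide)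
  have t10 := htri0 1 0 (by decide)
  have t03 := htri0 0 3 (by decide)
  have t13 := htri0 1 3 (by decide)
  have t30 := htri0 3 0 (by decide)
  have t31 := htri0 3 1 (by decide)
  have t22 : S 2 2 ↔ ¬ R 2 2 := by
    constructor
    · intro h h'
      exact notboth 2 2 h' h
    · intro h
      by_contra h'
      have E := heq 2 2 h h' 0 1 (by omega)
      have R20 : R 2 0 := by
        rw [← hR 2 0 0 1 (by omega), E]
        exact y20 1
      have S21 : S 2 1 := by
        rw [← hS 2 1 0 1 (by omega), E]
        exact y12 1
      by_cases h23 : R 2 3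
      · exact n31 2 (Or.inl ⟨h23, S21⟩)
      · exact n03 2 (Or.inl ⟨R20, t23.2 h23⟩)
  have R00 : R 0 0 := by
    by_contra h
    exact n30 0 (Or.inl ⟨R03, t00.2 h⟩)
  have R01 : R 0 1 := by
    by_contra h
    exact n31 0 (Or.inl ⟨R03, t01.2 h⟩)
  have R10 : R 1 0 := by
    by_contra h
    exact n30 1 (Or.inl ⟨R13, t10.2 h⟩)
  have R11 : R 1 1 := by
    by_contra h
    exact n31 1 (Or.inl ⟨R13, t11.2 h⟩)
  have s0 : R 2 0 ↔ R 2 3 :=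
    ⟨fun h => by_contra fun h' => n03 2 (Or.inl ⟨h, t23.2 h'⟩),
      fun h => by_contra fun h' => n30 2 (Or.inl ⟨h, t20.2 h'⟩)⟩
  have s1 : R 2 1 ↔ R 2 3 :=
    ⟨fun h => by_contra fun h' => n13 2 (Or.inl ⟨h, t23.2 h'⟩),
      fun h => by_contra fun h' => n31 2 (Or.inl ⟨h, t21.2 h'⟩)⟩
  have u0 : R 0 2 ↔ R 3 2 :=
    ⟨fun h => by_contra fun h' => n30 2 (Or.inr ⟨t32.2 h', h⟩),
      fun h => by_contra fun h' => n03 2 (Or.inr ⟨t02.2 h', h⟩)⟩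
  have u1 : R 1 2 ↔ R 3 2 :=
    ⟨fun h => by_contra fun h' => n31 2 (Or.inr ⟨t32.2 h', h⟩),
      fun h => by_contra fun h' => n13 2 (Or.inr ⟨t12.2 h', h⟩)⟩
  have R32 : R 3 2 := by
    by_contra h
    exact hexp (hom_exp2 hT hR hS 1 2 0 t11 t22 (Or.inl ⟨R01, t02.2 fun h' => h (u0.1 h')⟩) y12
      fun h' => h (u1.1 h'))
  have R23 : R 2 3 := by
    by_contra h
    exact hexp (hom_exp2 hT hR hS 2 0 0 t22 t00 (Or.inr ⟨t20.2 fun h' => h (s0.1 h'), R00⟩) y20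
      fun h' => h (s0.1 h'))
  have R22 : R 2 2 := by
    by_contra h
    exact hexp (hom_exp1 hT hR hS 0 2 2 t00 t22 (Or.inl ⟨s0.2 R23, t22.2 h⟩)
      fun h' => t20.1 (h'.1 (u0.2 R32)) (s0.2 R23))
  apply hexp
  refine exp_tri hT ![y 0, y 1, y 2] ?_ y01 y12 y20
  intro i j hij p q
  have R02 := u0.2 R32
  have R12 := u1.2 R32
  have R20 := s0.2 R23
  have R21 := s1.2 R23
  fin_cases p <;> fin_cases q
  · exact (hR 0 0 i j hij).2 R00
  · exact (hR 0 1 i j hij).2 R01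
  · exact (hR 0 2 i j hij).2 R02
  · exact (hR 1 0 i j hij).2 R10
  · exact (hR 1 1 i j hij).2 R11
  · exact (hR 1 2 i j hij).2 R12
  · exact (hR 2 0 i j hij).2 R20
  · exact (hR 2 1 i j hij).2 R21
  · exact (hR 2 2 i j hij).2 R22

/-! ### Acyclic modules -/

/-- Acyclic autonomous sets. -/
def IsAcMod (ρ : V → V → Prop) (M : Set V) : Prop :=
  (∀ z ∉ M, ∀ u ∈ M, ∀ v ∈ M, ρ u z → ρ v z) ∧
    ∀ x ∈ M, ∀ y ∈ M, ∀ z ∈ M, ρ x y → ρ y z → ρ x z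

theorem exp_chain {ρ : V → V → Prop} (hT : IsTournament ρ) (x : ℕ → V)
    (hx : ∀ i j, i < j → ρ (x i) (x j))
    (hm : ∀ i j, i < j → ¬ ∃ M, IsAcMod ρ M ∧ x i ∈ M ∧ x j ∈ M) : ExpG ρ := by
  obtain ⟨g, hg, k, hk⟩ := ramsey_pairs (K := Prop)
    (fun i j => ∃ z, ρ (x j) z ∧ ρ z (x i))
  let u : ℕ → V := fun i => x (g i)
  have hu : ∀ i j, i < j → ρ (u i) (u j) := fun i j h => hx _ _ (hg h)
  have hum : ∀ i j, i < j → ¬ ∃ M, IsAcMod ρ M ∧ u i ∈ M ∧ u j ∈ M := fun i j h => hm _ _ (hg h)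
  by_cases hk' : k
  · have hc : ∀ i, ∃ z, ρ (u (3 * i + 1)) z ∧ ρ z (u (3 * i)) := by
      intro i
      have := hk (3 * i) (3 * i + 1) (by omega)
      rw [eq_iff_iff] at this
      exact this.2 hk'
    choose c hc using hc
    refine exp_main4 hT (fun i => u (3 * i)) (fun i => u (3 * i + 1)) c (fun i => u (3 * i + 2))
      ?_ ?_ ?_ ?_ ?_ (fun i => (hc i).1) (fun i => (hc i).2)
    · intro i j hij; exact hu _ _ (by omega)
    · intro i j hij; exact hu _ _ (by omega)
    · intro i j hij; exact hu _ _ (by omega)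
    · intro i j hij; exact hu _ _ (by omega)
    · intro i; exact hu _ _ (by omega)
  · have hno : ∀ i j, i < j → ∀ z, ρ (u j) z → ¬ ρ z (u i) := by
      intro i j hij z h1 h2
      have := hk i j hij
      rw [eq_iff_iff] at this
      exact hk' (this.1 ⟨z, h1, h2⟩)
    have key : ∀ t, ∃ a b c, (a = u t ∨ a = u (t + 1) ∨ (ρ (u t) a ∧ ρ a (u (t + 1)))) ∧
        (b = u t ∨ b = u (t + 1) ∨ (ρ (u t) b ∧ ρ b (u (t + 1)))) ∧
        ρ a b ∧ ρ b c ∧ ρ c a := by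
      intro t
      have hut := hu t (t + 1) (by omega)
      by_contra hcon
      push Not at hcon
      apply hum t (t + 1) (by omega)
      refine ⟨{z | z = u t ∨ z = u (t + 1) ∨ (ρ (u t) z ∧ ρ z (u (t + 1)))}, ⟨?_, ?_⟩,
        Or.inl rfl, Or.inr (Or.inl rfl)⟩
      · intro z hz p hp q hq hpz
        by_contra hqz
        have hzq : q ≠ z := by
          rintro rfl
          exact hz hq
        have hqz' := hT.of_not hzq hqz
        have hz0 : z ≠ u t := fun h => hz (Or.inl h)
        have hz1 : z ≠ u (t + 1) := fun h => hz (Or.inr (Or.inl h))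
        have hz2 : ¬ (ρ (u t) z ∧ ρ z (u (t + 1))) := fun h => hz (Or.inr (Or.inr h))
        by_cases h0 : ρ z (u t)
        · have h1 : ρ z (u (t + 1)) := by
            by_contra h1
            exact hno t (t + 1) (by omega) z (hT.of_not hz1 h1) h0
          rcases hp with rfl | rfl | hp
          · exact hT.asymm h0 hpz
          · exact hT.asymm h1 hpz
          · exact hcon (u t) p z (Or.inl rfl) (Or.inr (Or.inr hp)) hp.1 hpz h0
        · have h0' := hT.of_not hz0 h0
          have h1 : ρ (u (t + 1)) z := by
            apply hT.of_not hz1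
            tauto
          rcases hq with rfl | rfl | hq
          · exact hT.asymm h0' hqz'
          · exact hT.asymm h1 hqz'
          · exact hcon q (u (t + 1)) z (Or.inr (Or.inr hq)) (Or.inr (Or.inl rfl)) hq.2 h1 hqz'
      · intro p hp q hq r hr hpq hqr
        by_contra hpr
        have hne : p ≠ r := by
          rintro rfl
          exact hT.asymm hpq hqr
        exact hcon p q r hp hq hpq hqr (hT.of_not hne hpr)
    choose a b c ha hb hab hbc hca using key
    have fwd : ∀ t j z, t + 1 < j →
        (z = u t ∨ z = u (t + 1) ∨ (ρ (u t) z ∧ ρ z (u (t + 1)))) → ρ z (u j) := by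
      rintro t j z htj (rfl | rfl | h)
      · exact hu _ _ (by omega)
      · exact hu _ _ (by omega)
      · by_contra hcon
        have hne : z ≠ u j := by
          rintro rfl
          exact hT.asymm h.2 (hu _ _ htj)
        exact hno (t + 1) j htj z (hT.of_not hne hcon) h.2
    have bwd : ∀ t j z, j < t →
        (z = u t ∨ z = u (t + 1) ∨ (ρ (u t) z ∧ ρ z (u (t + 1)))) → ρ (u j) z := by
      rintro t j z htj (rfl | rfl | h)
      · exact hu _ _ (by omega)
      · exact hu _ _ (by omega)
      · by_contra hcon
        have hne : u j ≠ z := by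
          rintro rfl
          exact hT.asymm h.1 (hu _ _ htj)
        exact hno j t htj z h.1 (hT.of_not hne hcon)
    refine exp_main4 hT (fun i => a (3 * i)) (fun i => b (3 * i)) (fun i => c (3 * i))
      (fun i => u (3 * i + 2)) ?_ ?_ ?_ ?_ (fun i => hab _) (fun i => hbc _) (fun i => hca _)
    · intro i j hij; exact fwd _ _ _ (by omega) (ha _)
    · intro i j hij; exact fwd _ _ _ (by omega) (hb _)
    · intro i j hij; exact bwd _ _ _ (by omega) (ha _)
    · intro i j hij; exact bwd _ _ _ (by omega) (hb _)

lemma isTournament_rev {ρ : V → V → Prop} (hT : IsTournament ρ) :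
    IsTournament (fun x y => ρ y x) :=
  ⟨hT.1, fun x y h => hT.2 y x h.symm⟩

lemma isAcMod_rev {ρ : V → V → Prop} (hT : IsTournament ρ) {M : Set V}
    (h : IsAcMod (fun x y => ρ y x) M) : IsAcMod ρ M := by
  refine ⟨fun z hz u hu v hv huz => ?_, fun x hx y hy z hz h1 h2 => h.2 z hz y hy x hx h2 h1⟩
  by_contra hvz
  have hne : v ≠ z := by
    rintro rfl
    exact hz hv
  exact hT.asymm huz (h.1 z hz v hv u hu (hT.of_not hne hvz))

/-- The union of two intersecting acyclic modules is an acyclic module. -/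
lemma isAcMod_union {ρ : V → V → Prop} (hT : IsTournament ρ) {M N : Set V}
    (hM : IsAcMod ρ M) (hN : IsAcMod ρ N) {y : V} (hyM : y ∈ M) (hyN : y ∈ N) :
    IsAcMod ρ (M ∪ N) := by
  have hM' : ∀ z ∉ M, ∀ u ∈ M, ∀ v ∈ M, ρ z u → ρ z v := by
    intro z hz u hu v hv h
    by_contra hcon
    have hne : z ≠ v := by rintro rfl; exact hz hv
    exact hT.asymm h (hM.1 z hz v hv u hu (hT.of_not hne hcon))
  have hN' : ∀ z ∉ N, ∀ u ∈ N, ∀ v ∈ N, ρ z u → ρ z v := by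
    intro z hz u hu v hv h
    by_contra hcon
    have hne : z ≠ v := by rintro rfl; exact hz hv
    exact hT.asymm h (hN.1 z hz v hv u hu (hT.of_not hne hcon))
  constructor
  · intro z hz u hu v hv huz
    have hzM : z ∉ M := fun h => hz (Or.inl h)
    have hzN : z ∉ N := fun h => hz (Or.inr h)
    have h1 : ρ y z := by
      rcases hu with hu | hu
      · exact hM.1 z hzM u hu y hyM huz
      · exact hN.1 z hzN u hu y hyN huz
    rcases hv with hv | hv
    · exact hM.1 z hzM y hyM v hv h1
    · exact hN.1 z hzN y hyN v hv h1
  · -- arcs from a point of one set to a point outside are uniform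
    intro p hp q hq r hr hpq hqr
    by_contra hpr
    have hne : p ≠ r := by
      rintro rfl
      exact hT.asymm hpq hqr
    have hrp := hT.of_not hne hpr
    have hrot : ∀ p q r, p ∈ M → q ∈ M → r ∈ N → r ∉ M → ρ p q → ρ q r → ρ r p → False := by
      intro p q r hp hq hr hrM hpq hqr hrp
      exact hT.asymm hrp (hM.1 r hrM q hq p hp hqr)
    have hrot' : ∀ p q r, p ∈ N → q ∈ N → r ∈ M → r ∉ N → ρ p q → ρ q r → ρ r p → False := by
      intro p q r hp hq hr hrM hpq hqr hrp
      exact hT.asymm hrp (hN.1 r hrM q hq p hp hqr)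
    have tM := hM.2
    have tN := hN.2
    by_cases p1 : p ∈ M <;> by_cases q1 : q ∈ M <;> by_cases r1 : r ∈ M
    · exact hpr (hM.2 p p1 q q1 r r1 hpq hqr)
    · exact hrot p q r p1 q1 (hr.resolve_left r1) r1 hpq hqr hrp
    · exact hrot r p q r1 p1 (hq.resolve_left q1) q1 hrp hpq hqr
    · have q2 := hq.resolve_left q1
      have r2 := hr.resolve_left r1
      by_cases p2 : p ∈ N
      · exact hpr (hN.2 p p2 q q2 r r2 hpq hqr)
      · exact hrot' q r p q2 r2 p1 p2 hqr hrp hpq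
    · exact hrot q r p q1 r1 (hp.resolve_left p1) p1 hqr hrp hpq
    · have p2 := hp.resolve_left p1
      have r2 := hr.resolve_left r1
      by_cases q2 : q ∈ N
      · exact hpr (hN.2 p p2 q q2 r r2 hpq hqr)
      · exact hrot' r p q r2 p2 q1 q2 hrp hpq hqr
    · have p2 := hp.resolve_left p1
      have q2 := hq.resolve_left q1
      by_cases r2 : r ∈ N
      · exact hpr (hN.2 p p2 q q2 r r2 hpq hqr)
      · exact hrot' p q r p2 q2 r1 r2 hpq hqr hrp
    · exact hpr (hN.2 p (hp.resolve_left p1) q (hq.resolve_left q1) r (hr.resolve_left r1) hpq hqr)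

/-- Either a finite lexicographical sum of acyclic tournaments, or exponential growth. -/
theorem lexSum_or_exp {ρ : V → V → Prop} (hT : IsTournament ρ) :
    IsFiniteLexSumOfAcyclic ρ ∨ ExpG ρ := by
  classical
  let st : Setoid V :=
    { r := fun x y => ∃ M, IsAcMod ρ M ∧ x ∈ M ∧ y ∈ M
      iseqv := by
        refine ⟨fun x => ?_, ?_, ?_⟩
        · refine ⟨{x}, ⟨?_, ?_⟩, rfl, rfl⟩
          · rintro z hz u rfl v rfl h
            exact h
          · rintro a rfl b rfl c rfl h1 h2
            exact h1
        · rintro x y ⟨M, hM, hx, hy⟩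
          exact ⟨M, hM, hy, hx⟩
        · rintro x y z ⟨M, hM, hx, hy⟩ ⟨N, hN, hy', hz⟩
          exact ⟨M ∪ N, isAcMod_union hT hM hN hy hy', Or.inl hx, Or.inr hz⟩ }
  have hst : ∀ x y : V, (⟦x⟧ : Quotient st) = ⟦y⟧ ↔ ∃ M, IsAcMod ρ M ∧ x ∈ M ∧ y ∈ M :=
    fun x y => Quotient.eq
  by_cases hfin : Finite (Quotient st)
  · left
    obtain ⟨n, ⟨eq⟩⟩ := Finite.exists_equiv_fin (Quotient st)
    let rep : Fin n → V := fun i => (eq.symm i).out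
    let c : V → Fin n := fun x => eq ⟦x⟧
    have hc : ∀ x y, c x = c y ↔ ∃ M, IsAcMod ρ M ∧ x ∈ M ∧ y ∈ M := by
      intro x y
      rw [← hst]
      exact eq.injective.eq_iff
    have hrep : ∀ i, c (rep i) = i := by
      intro i
      simp [c, rep]
    have hinv1 : ∀ x x' y, c x = c x' → c x ≠ c y → ρ x y → ρ x' y := by
      intro x x' y h hne hxy
      obtain ⟨M, hM, hx, hx'⟩ := (hc x x').1 h
      have hyM : y ∉ M := fun hy => hne ((hc x y).2 ⟨M, hM, hx, hy⟩)
      exact hM.1 y hyM x hx x' hx' hxy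
    have hinv2 : ∀ x y y', c y = c y' → c x ≠ c y → ρ x y → ρ x y' := by
      intro x y y' h hne hxy
      by_contra hcon
      have hne' : x ≠ y' := by
        rintro rfl
        exact hne h.symm
      have := hinv1 y' y x h.symm (by rw [← h]; exact hne.symm) (hT.of_not hne' hcon)
      exact hT.asymm hxy this
    refine ⟨Fin n, fun i j => ρ (rep i) (rep j), c, inferInstance, ⟨fun i => hT.1 _, ?_⟩, ?_, ?_⟩
    · intro i j hij
      apply hT.2
      intro h
      apply hij
      rw [← hrep i, ← hrep j, h]
    · intro x y hxy
      constructor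
      · intro h
        have h1 := hinv1 x (rep (c x)) y (hrep _).symm hxy h
        exact hinv2 _ y (rep (c y)) (hrep _).symm (by rw [hrep]; exact hxy) h1
      · intro h
        have h1 := hinv1 _ x (rep (c y)) (hrep _) (by rw [hrep, hrep]; exact hxy) h
        exact hinv2 _ _ y (hrep _) (by rw [hrep]; exact hxy) h1
    · intro x y z hxy hyz h1 h2
      obtain ⟨M, hM, hx, hy⟩ := (hc x y).1 hxy
      obtain ⟨N, hN, hy', hz⟩ := (hc y z).1 hyz
      exact (isAcMod_union hT hM hN hy hy').2 x (Or.inl hx) y (Or.inl hy) z (Or.inr hz) h1 h2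
  · right
    have hinf : Infinite (Quotient st) := not_finite_iff_infinite.mp hfin
    let f := Infinite.natEmbedding (Quotient st)
    let x : ℕ → V := fun i => (f i).out
    have hx : ∀ i j, i ≠ j → ¬ ∃ M, IsAcMod ρ M ∧ x i ∈ M ∧ x j ∈ M := by
      intro i j hij h
      rw [← hst] at h
      simp only [x, Quotient.out_eq] at h
      exact hij (f.injective h)
    have hxne : ∀ i j, i ≠ j → x i ≠ x j := by
      intro i j hij h
      apply hij
      apply f.injective
      rw [← Quotient.out_eq (f i), ← Quotient.out_eq (f j)]
      exact congrArg _ h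
    obtain ⟨g, hg, k, hk⟩ := ramsey_pairs (K := Prop) (fun i j => ρ (x i) (x j))
    by_cases hk' : k
    · refine exp_chain hT (fun i => x (g i)) ?_ ?_
      · intro i j hij
        have := hk i j hij
        rw [eq_iff_iff] at this
        exact this.2 hk'
      · intro i j hij
        exact hx _ _ (hg hij).ne
    · apply expG_rev
      refine exp_chain (isTournament_rev hT) (fun i => x (g i)) ?_ ?_
      · intro i j hij
        have := hk i j hij
        rw [eq_iff_iff] at this
        exact hT.of_not (hxne _ _ (hg hij).ne) (fun h => hk' (this.1 h))
      · rintro i j hij ⟨M, hM, h⟩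
        exact hx _ _ (hg hij).ne ⟨M, isAcMod_rev hT hM, h⟩


/-! ### Finite lexicographical sums have polynomial profile -/

/-- `ρ` is decomposed as a lexicographical sum over the finite tournament `σ` on `ι`. -/
def LexDec (ρ : V → V → Prop) (ι : Type) (σ : ι → ι → Prop) (c : V → ι) : Prop :=
  Finite ι ∧ IsTournament σ ∧
    (∀ x y : V, c x ≠ c y → (ρ x y ↔ σ (c x) (c y))) ∧
    (∀ x y z : V, c x = c y → c y = c z → ρ x y → ρ y z → ρ x z)

/-- A decomposition with an index set of minimal size. -/
def MinDec (ρ : V → V → Prop) (ι : Type) (σ : ι → ι → Prop) (c : V → ι) : Prop :=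
  LexDec ρ ι σ c ∧ ∀ (ι' : Type) (σ' : ι' → ι' → Prop) (c' : V → ι'),
    LexDec ρ ι' σ' c' → Nat.card ι ≤ Nat.card ι'

lemma exists_minDec {ρ : V → V → Prop} (h : IsFiniteLexSumOfAcyclic ρ) :
    ∃ (ι : Type) (σ : ι → ι → Prop) (c : V → ι), MinDec ρ ι σ c := by
  classical
  have hex : ∃ d : ℕ, ∃ (ι : Type) (σ : ι → ι → Prop) (c : V → ι),
      LexDec ρ ι σ c ∧ Nat.card ι = d := by
    obtain ⟨ι, σ, c, h⟩ := h
    exact ⟨Nat.card ι, ι, σ, c, h, rfl⟩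
  obtain ⟨ι, σ, c, h1, h2⟩ := Nat.find_spec hex
  refine ⟨ι, σ, c, h1, fun ι' σ' c' h' => ?_⟩
  rw [h2]
  exact Nat.find_min' hex ⟨ι', σ', c', h', rfl⟩

lemma MinDec.surj {ρ : V → V → Prop} {ι : Type} {σ : ι → ι → Prop} {c : V → ι}
    (h : MinDec ρ ι σ c) : Function.Surjective c := by
  intro i
  by_contra hi
  obtain ⟨⟨hf, hσ, h1, h2⟩, hmin⟩ := h
  have := hmin (Set.range c) (fun a b => σ a b) (fun x => ⟨c x, x, rfl⟩)
    ⟨inferInstance, ⟨fun x => hσ.1 x, fun x y hxy => hσ.2 x y (fun e => hxy (Subtype.ext e))⟩,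
      fun x y hxy => h1 x y (fun e => hxy (Subtype.ext e)),
      fun x y z hxy hyz => h2 x y z (congrArg Subtype.val hxy) (congrArg Subtype.val hyz)⟩
  have h3 : Nat.card (Set.range c) < Nat.card ι := by
    have := Fintype.ofFinite ι
    rw [Nat.card_coe_set_eq, ← Set.ncard_univ]
    exact Set.ncard_lt_ncard (by
      rw [Set.ssubset_univ_iff]
      intro e
      exact hi (by rw [← Set.mem_range, e]; trivial)) (Set.toFinite _)
  omega

lemma MinDec.collapse {ρ : V → V → Prop} {ι : Type} {σ : ι → ι → Prop} {c : V → ι}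
    (h : MinDec ρ ι σ c) (J : Set ι)
    (hm : ∀ z, z ∉ J → ∀ u ∈ J, ∀ v ∈ J, σ u z → σ v z)
    (ht : ∀ u ∈ J, ∀ v ∈ J, ∀ w ∈ J, σ u v → σ v w → σ u w) :
    ∀ u ∈ J, ∀ v ∈ J, u = v := by
  classical
  intro j0 hj0 j1 hj1
  by_contra hne
  obtain ⟨⟨hf, hσ, h1, h2⟩, hmin⟩ := h
  have hm' : ∀ z, z ∉ J → ∀ u ∈ J, ∀ v ∈ J, σ z u → σ z v := by
    intro z hz u hu v hv hzu
    by_contra hzv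
    have hvz : z ≠ v := fun e => hz (e ▸ hv)
    have := hm z hz v hv u hu (IsTournament.of_not hσ hvz hzv)
    exact (hσ.2 z u (fun e => hz (e ▸ hu))).1 hzu this
  let c' : V → {i : ι // i ∈ J → i = j0} := fun x =>
    if hx : c x ∈ J then ⟨j0, fun _ => rfl⟩ else ⟨c x, fun hx' => absurd hx' hx⟩
  have c1 : ∀ x, c x ∈ J → (c' x : ι) = j0 := by
    intro x hx; simp [c', hx]
  have c2 : ∀ x, c x ∉ J → (c' x : ι) = c x := by
    intro x hx; simp [c', hx]
  have := hmin {i : ι // i ∈ J → i = j0} (fun a b => σ a b) c'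
    ⟨inferInstance, ⟨fun x => hσ.1 x, fun x y hxy => hσ.2 x y (fun e => hxy (Subtype.ext e))⟩,
      ?_, ?_⟩
  · have h3 : Nat.card {i : ι // i ∈ J → i = j0} < Nat.card ι := by
      have := Fintype.ofFinite ι
      change Nat.card ({i : ι | i ∈ J → i = j0} : Set ι) < _
      rw [Nat.card_coe_set_eq, ← Set.ncard_univ]
      exact Set.ncard_lt_ncard (by
        rw [Set.ssubset_univ_iff]
        intro e
        have : j1 ∈ {i : ι | i ∈ J → i = j0} := by rw [e]; trivial
        exact hne (this hj1).symm) (Set.toFinite _)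
    omega
  · intro x y hxy
    have hxy' : (c' x : ι) ≠ c' y := fun e => hxy (Subtype.ext e)
    change ρ x y ↔ σ (c' x : ι) (c' y : ι)
    by_cases hx : c x ∈ J <;> by_cases hy : c y ∈ J
    · exact absurd ((c1 x hx).trans (c1 y hy).symm) hxy'
    · rw [c1 x hx, c2 y hy, h1 x y (fun e => hy (e ▸ hx))]
      exact ⟨hm _ hy _ hx _ hj0, hm _ hy _ hj0 _ hx⟩
    · rw [c2 x hx, c1 y hy, h1 x y (fun e => hx (e ▸ hy))]
      exact ⟨hm' _ hx _ hy _ hj0, hm' _ hx _ hj0 _ hy⟩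
    · rw [c2 x hx, c2 y hy] at hxy' ⊢
      exact h1 x y hxy'
  · intro x y z hxy hyz rxy ryz
    have hxy' : (c' x : ι) = c' y := congrArg Subtype.val hxy
    have hyz' : (c' y : ι) = c' z := congrArg Subtype.val hyz
    have key : ∀ p q, (c' p : ι) = c' q → c p ∈ J → c q ∈ J := by
      intro p q hpq hp
      by_contra hq
      rw [c1 p hp, c2 q hq] at hpq
      exact hq (hpq ▸ hj0)
    by_cases hx : c x ∈ J
    · have hy := key _ _ hxy' hx
      have hz := key _ _ hyz' hy
      by_cases e1 : c x = c y
      · by_cases e2 : c y = c z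
        · exact h2 x y z e1 e2 rxy ryz
        · rw [h1 x z (e1 ▸ e2), e1, ← h1 y z e2]
          exact ryz
      · by_cases e2 : c y = c z
        · rw [h1 x z (e2 ▸ e1), ← e2, ← h1 x y e1]
          exact rxy
        · have s1 := (h1 x y e1).1 rxy
          have s2 := (h1 y z e2).1 ryz
          have e3 : c x ≠ c z := by
            intro e
            rw [← e] at s2
            exact (hσ.2 _ _ e1).1 s1 s2
          exact (h1 x z e3).2 (ht _ hx _ hy _ hz s1 s2)
    · have hy : c y ∉ J := fun hy => hx (key _ _ hxy'.symm hy)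
      have hz : c z ∉ J := fun hz => hy (key _ _ hyz'.symm hz)
      rw [c2 x hx, c2 y hy] at hxy'
      rw [c2 y hy, c2 z hz] at hyz'
      exact h2 x y z hxy' hyz' rxy ryz

lemma MinDec.const_on {ρ : V → V → Prop} {ι : Type} {σ : ι → ι → Prop} {c : V → ι}
    (h : MinDec ρ ι σ c) (A S : Set V) (hA : ∀ i, ∃ a ∈ A, c a = i) (hSA : S ⊆ A)
    (hm : ∀ z ∈ A, z ∉ S → ∀ u ∈ S, ∀ v ∈ S, ρ u z → ρ v z)
    (ht : ∀ u ∈ S, ∀ v ∈ S, ∀ w ∈ S, ρ u v → ρ v w → ρ u w) :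
    ∀ u ∈ S, ∀ v ∈ S, c u = c v := by
  have hσ := h.1.2.1
  have h1 := h.1.2.2.1
  intro u hu v hv
  refine h.collapse (c '' S) ?_ ?_ _ ⟨u, hu, rfl⟩ _ ⟨v, hv, rfl⟩
  · rintro z hz _ ⟨a, ha, rfl⟩ _ ⟨b, hb, rfl⟩ hab
    obtain ⟨w, hw, rfl⟩ := hA z
    have na : ∀ a ∈ S, c a ≠ c w := fun a ha e => hz ⟨a, ha, e⟩
    rw [← h1 _ _ (na b hb)]
    exact hm w hw (fun hw' => hz ⟨w, hw', rfl⟩) a ha b hb ((h1 _ _ (na a ha)).2 hab)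
  · rintro _ ⟨a, ha, rfl⟩ _ ⟨b, hb, rfl⟩ _ ⟨d, hd, rfl⟩ hab hbd
    have e1 : c a ≠ c b := fun e => hσ.1 _ (e ▸ hab)
    have e2 : c b ≠ c d := fun e => hσ.1 _ (e ▸ hbd)
    have e3 : c a ≠ c d := by
      intro e
      rw [← e] at hbd
      exact (hσ.2 _ _ e1).1 hab hbd
    exact (h1 _ _ e3).1 (ht a ha b hb d hd ((h1 _ _ e1).2 hab) ((h1 _ _ e2).2 hbd))

open Classical in
lemma MinDec.perm {ρ : V → V → Prop} {ι : Type} {σ : ι → ι → Prop} {c : V → ι}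
    (h : MinDec ρ ι σ c) (A B : Finset V) (hA : ∀ i, ∃ a ∈ A, c a = i)
    (hB : ∀ i, ∃ a ∈ B, c a = i) (hiso : BinIsoOn ρ (↑A : Set V) (↑B : Set V)) :
    ∃ π : Equiv.Perm ι, ∀ i, (A.filter (fun x => c x = i)).card =
      (B.filter (fun x => c x = π i)).card := by
  obtain ⟨f, hf, hr⟩ := hiso
  have hfin := h.1.1
  have hσ := h.1.2.1
  have h1 := h.1.2.2.1
  have h2 := h.1.2.2.2
  have key : ∀ x ∈ A, ∀ y ∈ A, c x = c y → c (f x) = c (f y) := by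
    intro x hx y hy hxy
    refine h.const_on (↑B) (f '' {z | z ∈ A ∧ c z = c x}) hB ?_ ?_ ?_ _ ⟨x, ⟨hx, rfl⟩, rfl⟩ _
      ⟨y, ⟨hy, hxy.symm⟩, rfl⟩
    · rintro _ ⟨z, ⟨hz, -⟩, rfl⟩
      exact hf.mapsTo hz
    · rintro z hz hzS _ ⟨u, ⟨hu, eu⟩, rfl⟩ _ ⟨v, ⟨hv, ev⟩, rfl⟩ huz
      obtain ⟨w, hw, rfl⟩ := hf.surjOn hz
      have hw' : c w ≠ c x := fun e => hzS ⟨w, ⟨hw, e⟩, rfl⟩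
      rw [← hr _ hu _ hw, h1 _ _ (by rw [eu]; exact hw'.symm), eu] at huz
      rw [← hr _ hv _ hw, h1 _ _ (by rw [ev]; exact hw'.symm), ev]
      exact huz
    · rintro _ ⟨u, ⟨hu, eu⟩, rfl⟩ _ ⟨v, ⟨hv, ev⟩, rfl⟩ _ ⟨w, ⟨hw, ew⟩, rfl⟩ huv hvw
      rw [← hr _ hu _ hv] at huv
      rw [← hr _ hv _ hw] at hvw
      rw [← hr _ hu _ hw]
      exact h2 _ _ _ (eu.trans ev.symm) (ev.trans ew.symm) huv hvw
  choose r hrA hrc using hA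
  let g : ι → ι := fun i => c (f (r i))
  have hg : ∀ x ∈ A, g (c x) = c (f x) := fun x hx => key _ (hrA _) _ hx (hrc _)
  have hgs : Function.Surjective g := by
    intro i
    obtain ⟨b, hb, rfl⟩ := hB i
    obtain ⟨a, ha, rfl⟩ := hf.surjOn hb
    exact ⟨c a, hg a ha⟩
  have hgb : Function.Bijective g := Finite.surjective_iff_bijective.1 hgs
  refine ⟨Equiv.ofBijective g hgb, fun i => ?_⟩
  refine Finset.card_bij (fun x _ => f x) ?_ ?_ ?_
  · intro x hx
    simp only [Finset.mem_filter] at hx ⊢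
    refine ⟨hf.mapsTo hx.1, ?_⟩
    rw [← hg x hx.1, hx.2]
    rfl
  · intro x hx y hy e
    simp only [Finset.mem_filter] at hx hy
    exact hf.injOn hx.1 hy.1 e
  · intro b hb
    simp only [Finset.mem_filter] at hb
    obtain ⟨a, ha, rfl⟩ := hf.surjOn hb.1
    refine ⟨a, ?_, rfl⟩
    simp only [Finset.mem_filter]
    refine ⟨ha, hgb.1 ?_⟩
    rw [hg a ha, hb.2]
    rfl

lemma iso_of_trans {ρ : V → V → Prop} [Nonempty V] (hT : IsTournament ρ) (A B : Finset V)
    (hA : ∀ x ∈ A, ∀ y ∈ A, ∀ z ∈ A, ρ x y → ρ y z → ρ x z)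
    (hB : ∀ x ∈ B, ∀ y ∈ B, ∀ z ∈ B, ρ x y → ρ y z → ρ x z) (hc : A.card = B.card) :
    BinIsoOn ρ (↑A : Set V) (↑B : Set V) := by
  classical
  have key : ∀ A : Finset V, (∀ x ∈ A, ∀ y ∈ A, ∀ z ∈ A, ρ x y → ρ y z → ρ x z) →
      ∃ e : Fin A.card ≃ A, ∀ i j, i < j ↔ ρ (e i) (e j) := by
    intro A hA
    let r : A → A → Prop := fun x y => ρ x y
    have hs : IsStrictTotalOrder A r :=
      { trichotomous := by
          intro a b hab hba
          by_contra hne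
          exact hba (IsTournament.of_not hT (fun e => hne (Subtype.ext e)) hab)
        irrefl := fun a => hT.1 a
        trans := fun a b d => hA a a.2 b b.2 d d.2 }
    let lo : LinearOrder A := linearOrderOfSTO r
    let e := Fintype.orderIsoFinOfCardEq A (Fintype.card_coe A)
    exact ⟨e.toEquiv, fun i j => (e.lt_iff_lt (x := i) (y := j)).symm⟩
  obtain ⟨e, he⟩ := key A hA
  obtain ⟨e', he'⟩ := key B hB
  let g : A ≃ B := (e.symm.trans (finCongr hc)).trans e'
  have hg : ∀ x y : A, ρ x y ↔ ρ (g x) (g y) := by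
    intro x y
    have := he (e.symm x) (e.symm y)
    rw [e.apply_symm_apply, e.apply_symm_apply] at this
    rw [← this]
    simp only [g, Equiv.trans_apply]
    rw [← he']
    simp
  refine ⟨fun x => if hx : x ∈ A then g ⟨x, hx⟩ else x, ⟨?_, ?_, ?_⟩, ?_⟩
  · intro x hx
    have hx : x ∈ A := hx
    simp [hx]
  · intro x hx y hy e
    have hx : x ∈ A := hx
    have hy : y ∈ A := hy
    simp only [hx, hy, dif_pos] at e
    exact congrArg Subtype.val (g.injective (Subtype.ext e))
  · intro y hy
    refine ⟨g.symm ⟨y, hy⟩, (g.symm ⟨y, hy⟩).2, ?_⟩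
    simp
  · intro a ha b hb
    have ha : a ∈ A := ha
    have hb : b ∈ A := hb
    simp only [ha, hb, dif_pos]
    exact hg ⟨a, ha⟩ ⟨b, hb⟩

open Classical in
lemma LexDec.iso {ρ : V → V → Prop} [Nonempty V] (hT : IsTournament ρ) {ι : Type}
    {σ : ι → ι → Prop} {c : V → ι}
    (h : LexDec ρ ι σ c) (A B : Finset V)
    (hc : ∀ i, (A.filter (fun x => c x = i)).card = (B.filter (fun x => c x = i)).card) :
    BinIsoOn ρ (↑A : Set V) (↑B : Set V) := by
  obtain ⟨hf, hσ, h1, h2⟩ := h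
  have tr : ∀ (A : Finset V) i, ∀ x ∈ A.filter (fun x => c x = i),
      ∀ y ∈ A.filter (fun x => c x = i), ∀ z ∈ A.filter (fun x => c x = i),
      ρ x y → ρ y z → ρ x z := by
    intro A i x hx y hy z hz
    simp only [Finset.mem_filter] at hx hy hz
    exact h2 x y z (hx.2.trans hy.2.symm) (hy.2.trans hz.2.symm)
  choose f hf hr using fun i => iso_of_trans hT _ _ (tr A i) (tr B i) (hc i)
  have mA : ∀ x ∈ A, x ∈ (↑(A.filter (fun y => c y = c x)) : Set V) := by
    intro x hx; simpa using hx
  have hfx : ∀ x ∈ A, f (c x) x ∈ B ∧ c (f (c x) x) = c x := by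
    intro x hx
    have := (hf (c x)).mapsTo (mA x hx)
    simpa using this
  refine ⟨fun x => f (c x) x, ⟨fun x hx => (hfx x hx).1, ?_, ?_⟩, ?_⟩
  · intro x hx y hy e
    have e : f (c x) x = f (c y) y := e
    have hxy : c x = c y := by rw [← (hfx x hx).2, e, (hfx y hy).2]
    rw [← hxy] at e
    refine (hf (c x)).injOn (mA x hx) ?_ e
    rw [hxy]
    exact mA y hy
  · intro y hy
    have hy' : y ∈ (↑(B.filter (fun z => c z = c y)) : Set V) := by simpa using hy
    obtain ⟨x, hx, hxy⟩ := (hf (c y)).surjOn hy'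
    have hx' : x ∈ A ∧ c x = c y := by simpa using hx
    refine ⟨x, hx'.1, ?_⟩
    change f (c x) x = y
    rw [hx'.2, hxy]
  · intro a ha b hb
    by_cases e : c a = c b
    · have hb' := mA b hb
      rw [← e] at hb'
      have := hr (c a) a (mA a ha) b hb'
      rw [this]
      simp only [e]
    · change ρ a b ↔ ρ (f (c a) a) (f (c b) b)
      rw [h1 a b e, h1 _ _ (by rw [(hfx a ha).2, (hfx b hb).2]; exact e), (hfx a ha).2,
        (hfx b hb).2]

open Classical in
lemma exists_of_counts {ι : Type} [Fintype ι] (c : V → ι) (N : ι → ℕ)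
    (h : ∀ i, ∃ s : Finset V, (∀ x ∈ s, c x = i) ∧ s.card = N i) :
    ∃ A : Finset V, A.card = ∑ i, N i ∧ ∀ i, (A.filter (fun x => c x = i)).card = N i := by
  choose s hs hN using h
  have hfil : ∀ i, (Finset.univ.biUnion s).filter (fun x => c x = i) = s i := by
    intro i
    ext x
    simp only [Finset.mem_filter, Finset.mem_biUnion, Finset.mem_univ, true_and]
    constructor
    · rintro ⟨⟨j, hj⟩, rfl⟩
      rwa [hs j x hj]
    · intro hx
      exact ⟨⟨i, hx⟩, hs i x hx⟩
  refine ⟨Finset.univ.biUnion s, ?_, fun i => by rw [hfil, hN]⟩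
  rw [Finset.card_eq_sum_card_fiberwise (f := c) (t := Finset.univ) (fun x _ => Finset.mem_univ _)]
  exact Finset.sum_congr rfl fun i _ => by rw [hfil, hN]

open Classical in
lemma profile_upper {ρ : V → V → Prop} [Nonempty V] (hT : IsTournament ρ) {ι : Type} [Fintype ι]
    {σ : ι → ι → Prop} {c : V → ι} (h : LexDec ρ ι σ c) (K : Finset ι) (i0 : ι) (C : ℕ)
    (hC : ∀ i, i ∉ K → i ≠ i0 → ∀ s : Finset V, (∀ x ∈ s, c x = i) → s.card ≤ C) (n : ℕ) :
    binProfile ρ n ≤ (C + 1) ^ Fintype.card ι * (n + 1) ^ K.card := by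
  let N : IsoCl ρ n → ι → ℕ := fun q i => (q.out.1.filter (fun x => c x = i)).card
  have hNn : ∀ q i, N q i ≤ n := fun q i =>
    (Finset.card_le_card (Finset.filter_subset _ _)).trans q.out.2.le
  have hsum : ∀ q, ∑ i, N q i = n := by
    intro q
    rw [← q.out.2, Finset.card_eq_sum_card_fiberwise (f := c) (t := Finset.univ)
      (fun x _ => Finset.mem_univ _)]
  let Φ : IsoCl ρ n → (ι → Fin (C + 1)) × (K → Fin (n + 1)) := fun q =>
    (fun i => ⟨min (N q i) C, by omega⟩, fun i => ⟨N q i, by have := hNn q i; omega⟩)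
  have hΦ : Function.Injective Φ := by
    intro q q' e
    have e1 : ∀ i, min (N q i) C = min (N q' i) C := fun i =>
      congrArg Fin.val (congrFun (congrArg Prod.fst e) i)
    have e2 : ∀ i ∈ K, N q i = N q' i := fun i hi =>
      congrArg Fin.val (congrFun (congrArg Prod.snd e) ⟨i, hi⟩)
    have e3 : ∀ i, i ≠ i0 → N q i = N q' i := by
      intro i hi
      by_cases hK : i ∈ K
      · exact e2 i hK
      · have b : ∀ q, N q i ≤ C := fun q => hC i hK hi _ (fun x hx => (Finset.mem_filter.1 hx).2)
        have := e1 i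
        rwa [min_eq_left (b q), min_eq_left (b q')] at this
    have e4 : ∀ i, N q i = N q' i := by
      intro i
      by_cases hi : i = i0
      · subst hi
        have a1 := hsum q
        have a2 := hsum q'
        rw [← Finset.add_sum_erase _ _ (Finset.mem_univ i)] at a1 a2
        have : ∑ x ∈ Finset.univ.erase i, N q x = ∑ x ∈ Finset.univ.erase i, N q' x :=
          Finset.sum_congr rfl fun x hx => e3 x (Finset.ne_of_mem_erase hx)
        omega
      · exact e3 i hi
    rw [← Quot.out_eq q, ← Quot.out_eq q', isoCl_eq_iff]
    exact h.iso hT _ _ e4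
  have := Nat.card_le_card_of_injective Φ hΦ
  refine this.trans (le_of_eq ?_)
  simp [Nat.card_eq_fintype_card]

open Classical in
lemma profile_lower {ρ : V → V → Prop} {ι : Type} [Fintype ι]
    {σ : ι → ι → Prop} {c : V → ι} (h : MinDec ρ ι σ c) [Nonempty V] (K : Finset ι) (i0 : ι)
    (hi0 : i0 ∉ K)
    (hK : ∀ i, i ∈ K ∨ i = i0 → ∀ m : ℕ, ∃ s : Finset V, (∀ x ∈ s, c x = i) ∧ s.card = m)
    (n s : ℕ) (hs : 1 ≤ s) (hsn : Fintype.card ι * s ≤ n) :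
    s ^ K.card ≤ binProfile ρ n * (Fintype.card ι).factorial := by
  let M : (K → Fin s) → ι → ℕ := fun t i => if hi : i ∈ K then (t ⟨i, hi⟩ : ℕ) + 1 else 1
  have hM1 : ∀ t i, 1 ≤ M t i := by
    intro t i; simp only [M]; split_ifs <;> omega
  have hMs : ∀ t i, M t i ≤ s := by
    intro t i; simp only [M]; split_ifs
    · exact (t _).2
    · exact hs
  have hrest : ∀ t, ∑ i ∈ Finset.univ.erase i0, M t i + s ≤ n := by
    intro t
    have : ∑ i ∈ Finset.univ.erase i0, M t i ≤ (Finset.univ.erase i0).card * s := by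
      have := Finset.sum_le_card_nsmul (Finset.univ.erase i0) (M t) s (fun i _ => hMs t i)
      simpa using this
    rw [Finset.card_erase_of_mem (Finset.mem_univ _), Finset.card_univ] at this
    have hpos : 1 ≤ Fintype.card ι := Fintype.card_pos_iff.2 ⟨i0⟩
    obtain ⟨d, hd⟩ := Nat.exists_eq_add_of_le' hpos
    rw [hd] at this hsn
    rw [Nat.add_sub_cancel] at this
    rw [Nat.add_mul] at hsn
    omega
  let N : (K → Fin s) → ι → ℕ := fun t i =>
    if i = i0 then n - ∑ i ∈ Finset.univ.erase i0, M t i else M t i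
  have hN1 : ∀ t i, 1 ≤ N t i := by
    intro t i
    have := hrest t
    have := hM1 t i
    simp only [N]; split_ifs <;> omega
  have hNsum : ∀ t, ∑ i, N t i = n := by
    intro t
    rw [← Finset.add_sum_erase _ _ (Finset.mem_univ i0)]
    have : ∑ x ∈ Finset.univ.erase i0, N t x = ∑ x ∈ Finset.univ.erase i0, M t x :=
      Finset.sum_congr rfl fun x hx => by simp [N, Finset.ne_of_mem_erase hx]
    rw [this]
    have h3 := hrest t
    simp only [N, if_true]
    omega
  have hex : ∀ t, ∃ A : Finset V, A.card = ∑ i, N t i ∧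
      ∀ i, (A.filter (fun x => c x = i)).card = N t i := by
    intro t
    refine exists_of_counts c (N t) fun i => ?_
    by_cases hi : i ∈ K ∨ i = i0
    · exact hK i hi _
    · push Not at hi
      obtain ⟨x, hx⟩ := h.surj i
      refine ⟨{x}, by simp [hx], ?_⟩
      simp [N, M, hi.1, hi.2]
  choose A hAc hAN using hex
  have hmeet : ∀ t i, ∃ a ∈ A t, c a = i := by
    intro t i
    have : 0 < ((A t).filter (fun x => c x = i)).card := by rw [hAN]; exact hN1 t i
    obtain ⟨a, ha⟩ := Finset.card_pos.1 this
    exact ⟨a, (Finset.mem_filter.1 ha).1, (Finset.mem_filter.1 ha).2⟩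
  let g : (K → Fin s) → IsoCl ρ n := fun t => Quot.mk _ ⟨A t, (hAc t).trans (hNsum t)⟩
  have hne : Nonempty (K → Fin s) := ⟨fun _ => ⟨0, hs⟩⟩
  have hrep : ∀ t, g t = g (Function.invFun g (g t)) := fun t =>
    (Function.invFun_eq ⟨t, rfl⟩).symm
  have hperm : ∀ t, ∃ π : Equiv.Perm ι, ∀ i, N t i = N (Function.invFun g (g t)) (π i) := by
    intro t
    have hiso := (isoCl_eq_iff _ _).1 (hrep t)
    obtain ⟨π, hπ⟩ := h.perm _ _ (hmeet t) (hmeet _) hiso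
    refine ⟨π, fun i => ?_⟩
    rw [← hAN, hπ i, hAN]
  choose π hπ using hperm
  let Φ : (K → Fin s) → IsoCl ρ n × Equiv.Perm ι := fun t => (g t, π t)
  have hΦ : Function.Injective Φ := by
    intro t t' e
    have e1 : g t = g t' := congrArg Prod.fst e
    have e2 : π t = π t' := congrArg Prod.snd e
    funext i
    have a1 := hπ t i
    have a2 := hπ t' i
    rw [e1, e2, ← a2] at a1
    have hi : (i : ι) ≠ i0 := fun e => hi0 (e ▸ i.2)
    simp only [N, M, hi, if_false, i.2, dif_pos] at a1
    exact Fin.ext (by simpa using a1)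
  have := isoCl_finite ρ n
  have := Nat.card_le_card_of_injective Φ hΦ
  rw [Nat.card_prod] at this
  have h4 : Nat.card (Equiv.Perm ι) = (Fintype.card ι).factorial := by
    rw [Nat.card_eq_fintype_card, Fintype.card_perm]
  rw [h4] at this
  have h5 : Nat.card (K → Fin s) = s ^ K.card := by
    simp [Nat.card_eq_fintype_card]
  rw [h5] at this
  exact this

theorem poly_of_lexSum [Infinite V] {ρ : V → V → Prop} (hT : IsTournament ρ)
    (h : IsFiniteLexSumOfAcyclic ρ) :
    ∃ (k : ℕ) (a b : ℝ), 0 < a ∧ 0 < b ∧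
          ∀ᶠ n : ℕ in Filter.atTop,
            a * (n : ℝ) ^ k ≤ (binProfile ρ n : ℝ) ∧ (binProfile ρ n : ℝ) ≤ b * (n : ℝ) ^ k := by
  classical
  obtain ⟨ι, σ, c, h⟩ := exists_minDec h
  have hfin := h.1.1
  have := Fintype.ofFinite ι
  obtain ⟨i0, hi0⟩ := Finite.exists_infinite_fiber c
  have hi0 : (c ⁻¹' {i0}).Infinite := Set.infinite_coe_iff.1 hi0
  let K : Finset ι := Finset.univ.filter fun i => (c ⁻¹' {i}).Infinite ∧ i ≠ i0
  have hKinf : ∀ i, i ∈ K ∨ i = i0 → ∀ m : ℕ, ∃ s : Finset V,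
      (∀ x ∈ s, c x = i) ∧ s.card = m := by
    intro i hi m
    have hinf : (c ⁻¹' {i}).Infinite := by
      rcases hi with hi | rfl
      · exact (Finset.mem_filter.1 hi).2.1
      · exact hi0
    obtain ⟨s, hs, hm⟩ := hinf.exists_subset_card_eq m
    exact ⟨s, fun x hx => hs hx, hm⟩
  let C : ℕ := ∑ i, (c ⁻¹' {i}).ncard
  have hC : ∀ i, i ∉ K → i ≠ i0 → ∀ s : Finset V, (∀ x ∈ s, c x = i) → s.card ≤ C := by
    intro i hi hne s hs
    have hf : (c ⁻¹' {i}).Finite := by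
      by_contra hf
      exact hi (Finset.mem_filter.2 ⟨Finset.mem_univ _, hf, hne⟩)
    have h1 : s.card ≤ (c ⁻¹' {i}).ncard := by
      rw [← Set.ncard_coe_finset]
      exact Set.ncard_le_ncard (fun x hx => hs x hx) hf
    exact h1.trans (Finset.single_le_sum (f := fun i => (c ⁻¹' {i}).ncard)
      (fun _ _ => Nat.zero_le _) (Finset.mem_univ i))
  have hup := profile_upper hT h.1 K i0 C hC
  have hlo := profile_lower h K i0 (by simp [K]) hKinf
  set d := Fintype.card ι with hd
  have hdpos : 0 < d := Fintype.card_pos_iff.2 ⟨i0⟩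
  have hdR : (0 : ℝ) < d := by exact_mod_cast hdpos
  have hfR : (0 : ℝ) < (d.factorial : ℝ) := by exact_mod_cast d.factorial_pos
  refine ⟨K.card, (1 / (2 * d)) ^ K.card / d.factorial, ((C : ℝ) + 1) ^ d * 2 ^ K.card,
    by positivity, by positivity, ?_⟩
  filter_upwards [Filter.eventually_ge_atTop d] with n hn
  constructor
  · have h1 := hlo n (n / d) (Nat.div_pos hn hdpos) (Nat.mul_div_le n d)
    have hs : (1 : ℝ) / (2 * d) * n ≤ ((n / d : ℕ) : ℝ) := by
      have h2 : n ≤ 2 * d * (n / d) := by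
        have := Nat.div_add_mod n d
        have := Nat.mod_lt n hdpos
        have : 1 ≤ n / d := Nat.div_pos hn hdpos
        have : d ≤ d * (n / d) := Nat.le_mul_of_pos_right d this
        rw [Nat.mul_assoc]
        omega
      have h3 : (n : ℝ) ≤ 2 * d * ((n / d : ℕ) : ℝ) := by exact_mod_cast h2
      rw [div_mul_eq_mul_div, one_mul, div_le_iff₀ (by positivity)]
      linarith
    have h2 : (((n / d : ℕ) : ℝ)) ^ K.card ≤ (binProfile ρ n : ℝ) * d.factorial := by
      exact_mod_cast h1
    rw [div_mul_eq_mul_div, div_le_iff₀ hfR, ← mul_pow]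
    exact (pow_le_pow_left₀ (by positivity) hs _).trans h2
  · have h1 : (binProfile ρ n : ℝ) ≤ ((C : ℝ) + 1) ^ d * ((n : ℝ) + 1) ^ K.card := by
      exact_mod_cast hup n
    refine h1.trans ?_
    rw [mul_assoc, ← mul_pow]
    have hn1 : (1 : ℝ) ≤ n := by exact_mod_cast hdpos.trans_le hn
    gcongr
    linarith

/-- **Theorem (Boudabbous–Pouzet).** The profile of an infinite tournament either has polynomial
growth — in which case the tournament is a lexicographical sum of acyclic tournaments indexed by
a finite tournament — or grows at least exponentially. -/
theorem tournament_profile_dichotomy [Infinite V] (ρ : V → V → Prop) (hT : IsTournament ρ) :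
    (IsFiniteLexSumOfAcyclic ρ ∧
        ∃ (k : ℕ) (a b : ℝ), 0 < a ∧ 0 < b ∧
          ∀ᶠ n : ℕ in Filter.atTop,
            a * (n : ℝ) ^ k ≤ (binProfile ρ n : ℝ) ∧ (binProfile ρ n : ℝ) ≤ b * (n : ℝ) ^ k) ∨
      (∃ c : ℝ, 1 < c ∧ ∀ᶠ n : ℕ in Filter.atTop, c ^ n ≤ (binProfile ρ n : ℝ)) := by
  rcases lexSum_or_exp hT with h | h
  · exact Or.inl ⟨h, poly_of_lexSum hT h⟩
  · exact Or.inr h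
end

section
/- Let K be an algebraically closed field of characteristic zero and let A = ⊕_{n≥0} A_n be a commutative graded K-algebra (with A_m · A_n ⊆ A_{m+n}) whose homogeneous components A_n are finite-dimensional K-vector spaces, and suppose A is an integral domain. Then for all natural numbers n and m with A_n ≠ 0 and A_m ≠ 0, the Hilbert function h_A (where h_A(n) := dim_K A_n) satisfies h_A(n) + h_A(m) − 1 ≤ h_A(n+m). -/
open Polynomial in
/-- If `x - c` has value one for every constant, so has every nonzero polynomial in `x`. -/
theorem hfs_val_aeval {K L : Type*} [Field K] [IsAlgClosed K] [Field L] [Algebra K L]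
    (O : ValuationSubring L) (hc : ∀ c : K, c ≠ 0 → O.valuation (algebraMap K L c) = 1)
    (x : L) (hx : ∀ c : K, O.valuation (x - algebraMap K L c) = 1)
    (q : K[X]) (hq : q ≠ 0) : O.valuation (aeval x q) = 1 := by
  have h := (IsAlgClosed.splits q).eq_prod_roots
  rw [h, map_mul, map_mul, map_multiset_prod, map_multiset_prod, aeval_C,
    hc _ (leadingCoeff_ne_zero.mpr hq), one_mul]
  apply Multiset.prod_eq_one
  intro y hy
  simp only [Multiset.map_map, Multiset.mem_map, Function.comp] at hy
  obtain ⟨a, -, rfl⟩ := hy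
  simpa using hx a

theorem hfs_const {K L : Type*} [Field K] [Field L] [Algebra K L]
    (O : ValuationSubring L) (hK : ∀ c : K, algebraMap K L c ∈ O) (c : K) (h : c ≠ 0) :
    O.valuation (algebraMap K L c) = 1 := by
  have hv : O.valuation (algebraMap K L c) * O.valuation (algebraMap K L c⁻¹) = 1 := by
    rw [← map_mul, ← map_mul, mul_inv_cancel₀ h]; simp
  have h1 := (O.valuation_le_one_iff _).mpr (hK c)
  have h2 := (O.valuation_le_one_iff _).mpr (hK c⁻¹)
  refine le_antisymm h1 ?_
  rw [← hv]
  exact mul_le_of_le_one_right' h2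

/-- A minimal valuation ring of `L` containing `K`. -/
theorem hfs_exists_min (K L : Type*) [Field K] [Field L] [Algebra K L] :
    ∃ O : ValuationSubring L, (∀ c : K, algebraMap K L c ∈ O) ∧
      ∀ O' : ValuationSubring L, (∀ c : K, algebraMap K L c ∈ O') → O' ≤ O → O ≤ O' := by
  obtain ⟨m, -, hm⟩ := @zorn_le_nonempty₀ (ValuationSubring L)ᵒᵈ _
    {O : ValuationSubring L | ∀ c : K, algebraMap K L c ∈ O} (by
      intro c hc hchain y hy
      let S : Set (ValuationSubring L) := c
      have hch : ∀ a ∈ S, ∀ b ∈ S, a ≤ b ∨ b ≤ a := fun a ha b hb => (hchain.total ha hb).symm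
      let R : ValuationSubring L :=
        { carrier := {z | ∀ O ∈ S, z ∈ O}
          mul_mem' := fun ha hb O hO => mul_mem (ha O hO) (hb O hO)
          one_mem' := fun O hO => one_mem O
          add_mem' := fun ha hb O hO => add_mem (ha O hO) (hb O hO)
          zero_mem' := fun O hO => zero_mem O
          neg_mem' := fun ha O hO => neg_mem (ha O hO)
          mem_or_inv_mem' := by
            intro z
            by_contra! hcon
            obtain ⟨h1, h2⟩ := hcon
            simp only [Set.mem_ofPred_eq, not_forall] at h1 h2
            obtain ⟨P, hP, hzP⟩ := h1
            obtain ⟨Q, hQ, hzQ⟩ := h2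
            rcases hch P hP Q hQ with h | h
            · exact hzQ (h ((P.mem_or_inv_mem z).resolve_left hzP))
            · exact hzP (h ((Q.mem_or_inv_mem z).resolve_right hzQ)) }
      refine ⟨(R : ValuationSubring L), fun k O hO => hc hO k, ?_⟩
      intro O hO z hz
      exact hz O hO) (⊤ : ValuationSubring L) (fun c => ValuationSubring.mem_top _)
  exact ⟨m, hm.1, fun O' h1 h2 => hm.2 h1 h2⟩

open Polynomial in
/-- A valuation ring of `L / K` with residue field `K`. -/
theorem hfs_exists_place (K L : Type*) [Field K] [IsAlgClosed K] [Field L] [Algebra K L] :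
    ∃ O : ValuationSubring L, (∀ c : K, algebraMap K L c ∈ O) ∧
      ∀ x ∈ O, ∃ c : K, O.valuation (x - algebraMap K L c) < 1 := by
  obtain ⟨O, hK, hmin⟩ := hfs_exists_min K L
  refine ⟨O, hK, fun x hxO => ?_⟩
  by_contra! hcon
  have hx : ∀ c : K, O.valuation (x - algebraMap K L c) = 1 := fun c =>
    le_antisymm ((O.valuation_le_one_iff _).mpr (sub_mem hxO (hK c))) (hcon c)
  have hval := hfs_val_aeval O (hfs_const O hK) x hx
  have hpO : ∀ p : K[X], O.valuation (aeval x p) ≤ 1 := by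
    intro p
    by_cases hp : p = 0
    · simp [hp]
    · exact (hval p hp).le
  -- the product estimate
  have hmul : ∀ (a b : L) (p q : K[X]), O.valuation (a - aeval x p) < 1 →
      O.valuation (b - aeval x q) < 1 → O.valuation (a * b - aeval x (p * q)) < 1 := by
    intro a b p q ha hb
    have hb1 : O.valuation b ≤ 1 := by
      have : b = (b - aeval x q) + aeval x q := by ring
      rw [this]
      exact O.valuation.map_add_le hb.le (hpO q)
    have e : a * b - aeval x (p * q) = (a - aeval x p) * b + aeval x p * (b - aeval x q) := by
      rw [map_mul]; ring
    rw [e]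
    apply O.valuation.map_add_lt
    · rw [map_mul]; exact lt_of_le_of_lt (mul_le_of_le_one_right' hb1) ha
    · rw [map_mul]; exact lt_of_le_of_lt (mul_le_of_le_one_left' (hpO p)) hb
  have hadd : ∀ (a b : L) (p q : K[X]), O.valuation (a - aeval x p) < 1 →
      O.valuation (b - aeval x q) < 1 → O.valuation ((a + b) - aeval x (p + q)) < 1 := by
    intro a b p q ha hb
    have e : (a + b) - aeval x (p + q) = (a - aeval x p) + (b - aeval x q) := by
      rw [map_add]; ring
    rw [e]
    exact O.valuation.map_add_lt ha hb
  let R : Subring L :=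
    { carrier := {y | ∃ p : K[X], O.valuation (y - aeval x p) < 1}
      mul_mem' := fun ⟨p, hp⟩ ⟨q, hq⟩ => ⟨p * q, hmul _ _ _ _ hp hq⟩
      one_mem' := ⟨1, by simp⟩
      add_mem' := fun ⟨p, hp⟩ ⟨q, hq⟩ => ⟨p + q, hadd _ _ _ _ hp hq⟩
      zero_mem' := ⟨0, by simp⟩
      neg_mem' := by
        rintro a ⟨p, hp⟩
        refine ⟨-p, ?_⟩
        have : -a - aeval x (-p) = -(a - aeval x p) := by rw [map_neg]; ring
        rw [this, Valuation.map_neg]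
        exact hp }
  let I : Ideal R :=
    { carrier := {y | ∃ p : K[X], p.coeff 0 = 0 ∧ O.valuation ((y : L) - aeval x p) < 1}
      add_mem' := fun ⟨p, hp0, hp⟩ ⟨q, hq0, hq⟩ =>
        ⟨p + q, by simp [hp0, hq0], hadd _ _ _ _ hp hq⟩
      zero_mem' := ⟨0, by simp⟩
      smul_mem' := by
        rintro ⟨a, q, hq⟩ b ⟨p, hp0, hp⟩
        exact ⟨q * p, by simp [mul_coeff_zero, hp0], hmul _ _ _ _ hq hp⟩ }
  have hI : I ≠ ⊤ := by
    rw [Ideal.ne_top_iff_one]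
    rintro ⟨p, hp0, hp⟩
    have hne : (1 - p) ≠ 0 := by
      intro h
      have := congrArg (fun r => r.coeff 0) h
      simp [hp0] at this
    have := hval _ hne
    rw [map_sub, map_one] at this
    exact hp.ne this
  obtain ⟨B, hRB, hIB⟩ := Ideal.image_subset_nonunits_valuationSubring I hI
  have hmB : ∀ y, O.valuation y < 1 → y ∈ B.nonunits := by
    intro y hy
    exact hIB ⟨⟨y, 0, by simpa using hy⟩, ⟨0, by simp, by simpa using hy⟩, rfl⟩
  have hxB : x ∈ B.nonunits :=
    hIB ⟨⟨x, X, by simp⟩, ⟨X, by simp, by simp⟩, rfl⟩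
  have hKB : ∀ c : K, algebraMap K L c ∈ B := fun c => hRB ⟨C c, by simp⟩
  have hx1 : O.valuation x = 1 := by simpa using hx 0
  have hx0 : x ≠ 0 := by rintro rfl; simp at hx1
  have hBO : B ≤ O := by
    intro y hy
    by_contra hyO
    have : y⁻¹ ∈ O.nonunits := O.inv_mem_nonunits_iff.mpr (Or.inr hyO)
    have h2 := B.inv_mem_nonunits_iff.mp (hmB _ (O.mem_nonunits_iff.mp this))
    rcases h2 with h2 | h2
    · exact hyO (h2 ▸ zero_mem O)
    · exact h2 hy
  have hinv : x⁻¹ ∈ O := by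
    rw [← O.valuation_le_one_iff, map_inv₀, hx1, inv_one]
  exact (B.mem_nonunits_iff_or.mp hxB).elim hx0 (fun h => h (hmin B hKB hBO hinv))

/-- Elements of value less than `γ`. -/
def hfsBall {K L : Type*} [Field K] [Field L] [Algebra K L]
    (O : ValuationSubring L) (hK : ∀ c : K, algebraMap K L c ∈ O) (γ : O.ValueGroupˣ) :
    Submodule K L where
  carrier := {x | O.valuation x < γ}
  add_mem' := fun ha hb => O.valuation.map_add_lt ha hb
  zero_mem' := by simp
  smul_mem' := by
    intro c x hx
    simp only [Set.mem_ofPred_eq] at hx ⊢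
    rw [Algebra.smul_def, map_mul]
    exact lt_of_le_of_lt (mul_le_of_le_one_left' ((O.valuation_le_one_iff _).mpr (hK c))) hx

/-- Values attained on `V` are at most `dim V` in number. -/
theorem hfs_card_le {K L : Type*} [Field K] [Field L] [Algebra K L]
    (O : ValuationSubring L) (hK : ∀ c : K, algebraMap K L c ∈ O) (T : Finset O.ValueGroupˣ) :
    ∀ (V : Submodule K L) [FiniteDimensional K V],
      (∀ γ ∈ T, ∃ x ∈ V, O.valuation x = γ) → T.card ≤ Module.finrank K V := by
  classical
  induction T using Finset.induction_on_max with
  | empty => intro V _ _; simp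
  | insert γ T hT ih =>
    intro V _ hV
    have hle : V ⊓ hfsBall O hK γ ≤ V := inf_le_left
    have : FiniteDimensional K ↥(V ⊓ hfsBall O hK γ) := Submodule.finiteDimensional_of_le hle
    have h1 := ih (V ⊓ hfsBall O hK γ) (by
      intro δ hδ
      obtain ⟨x, hx, hxv⟩ := hV δ (Finset.mem_insert_of_mem hδ)
      refine ⟨x, ⟨hx, ?_⟩, hxv⟩
      change O.valuation x < γ
      rw [hxv]
      exact_mod_cast hT δ hδ)
    obtain ⟨x, hx, hxv⟩ := hV γ (Finset.mem_insert_self _ _)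
    have hlt : V ⊓ hfsBall O hK γ < V := by
      refine lt_of_le_of_ne hle (fun h => ?_)
      have hx2 : x ∈ V ⊓ hfsBall O hK γ := by rw [h]; exact hx
      exact (hx2.2 : O.valuation x < γ).ne hxv
    have h2 := Submodule.finrank_lt_finrank_of_lt hlt
    rw [Finset.card_insert_of_notMem (fun h => (hT γ h).false)]
    omega

/-- If the residue field is `K`, then `dim V` is at most the number of values attained. -/
theorem hfs_le_card {K L : Type*} [Field K] [Field L] [Algebra K L]
    (O : ValuationSubring L) (hK : ∀ c : K, algebraMap K L c ∈ O)
    (hres : ∀ x ∈ O, ∃ c : K, O.valuation (x - algebraMap K L c) < 1)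
    (T : Finset O.ValueGroupˣ) :
    ∀ (V : Submodule K L) [FiniteDimensional K V],
      (∀ x ∈ V, x ≠ 0 → ∃ γ ∈ T, O.valuation x = γ) → Module.finrank K V ≤ T.card := by
  classical
  induction T using Finset.induction_on_max with
  | empty =>
    intro V _ hV
    have : V = ⊥ := by
      rw [eq_bot_iff]
      intro x hx
      by_contra h0
      obtain ⟨γ, hγ, -⟩ := hV x hx h0
      simp at hγ
    subst this
    simp
  | insert γ T hT ih =>
    intro V _ hV
    have hle : V ⊓ hfsBall O hK γ ≤ V := inf_le_left
    have : FiniteDimensional K ↥(V ⊓ hfsBall O hK γ) := Submodule.finiteDimensional_of_le hle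
    have h1 := ih (V ⊓ hfsBall O hK γ) (by
      intro x hx hx0
      obtain ⟨δ, hδ, hxv⟩ := hV x hx.1 hx0
      rcases Finset.mem_insert.mp hδ with rfl | hδ
      · exact absurd hxv (hx.2 : O.valuation x < δ).ne
      · exact ⟨δ, hδ, hxv⟩)
    rw [Finset.card_insert_of_notMem (fun h => (hT γ h).false)]
    by_cases hex : ∃ x ∈ V, O.valuation x = γ
    · obtain ⟨x, hx, hxv⟩ := hex
      have hx0 : x ≠ 0 := by
        rintro rfl
        rw [map_zero] at hxv
        exact γ.ne_zero hxv.symm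
      have hsub : V ≤ (V ⊓ hfsBall O hK γ) ⊔ Submodule.span K {x} := by
        intro y hy
        have hyγ : O.valuation y ≤ γ := by
          by_cases hy0 : y = 0
          · simp [hy0]
          obtain ⟨δ, hδ, hyv⟩ := hV y hy hy0
          rw [hyv]
          rcases Finset.mem_insert.mp hδ with rfl | hδ
          · exact le_rfl
          · exact_mod_cast (hT δ hδ).le
        have hq : y / x ∈ O := by
          rw [← O.valuation_le_one_iff, map_div₀, hxv]
          exact div_le_one_of_le₀ hyγ zero_le
        obtain ⟨c, hc⟩ := hres _ hq
        rw [show y = (y - c • x) + c • x by ring]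
        refine Submodule.add_mem_sup ⟨sub_mem hy (V.smul_mem c hx), ?_⟩
          (Submodule.smul_mem _ c (Submodule.mem_span_singleton_self x))
        change O.valuation (y - c • x) < γ
        have e : y - c • x = (y / x - algebraMap K L c) * x := by
          rw [Algebra.smul_def]; field_simp
        rw [e, map_mul, hxv]
        exact mul_lt_of_lt_one_left (zero_lt_iff.mpr γ.ne_zero) hc
      have h2 := Submodule.finrank_mono hsub
      have h3 := Submodule.finrank_add_le_finrank_add_finrank (V ⊓ hfsBall O hK γ)
        (Submodule.span K {x})
      have h4 := finrank_span_singleton (K := K) hx0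
      omega
    · have : V ≤ V ⊓ hfsBall O hK γ := by
        intro y hy
        refine ⟨hy, ?_⟩
        change O.valuation y < γ
        by_cases hy0 : y = 0
        · simp [hy0]
        obtain ⟨δ, hδ, hyv⟩ := hV y hy hy0
        rcases Finset.mem_insert.mp hδ with rfl | hδ
        · exact absurd ⟨y, hy, hyv⟩ hex
        · rw [hyv]; exact_mod_cast hT δ hδ
      have := Submodule.finrank_mono this
      omega

/-- The set of values of `V` as a finset. -/
theorem hfs_values {K L : Type*} [Field K] [Field L] [Algebra K L]
    (O : ValuationSubring L) (hK : ∀ c : K, algebraMap K L c ∈ O)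
    (V : Submodule K L) [FiniteDimensional K V] :
    ∃ T : Finset O.ValueGroupˣ, ∀ γ, γ ∈ T ↔ ∃ x ∈ V, O.valuation x = γ := by
  have hfin : {γ : O.ValueGroupˣ | ∃ x ∈ V, O.valuation x = γ}.Finite := by
    by_contra hinf
    obtain ⟨t, ht, hcard⟩ := Set.Infinite.exists_subset_card_eq hinf (Module.finrank K V + 1)
    have := hfs_card_le O hK t V (fun γ hγ => ht hγ)
    omega
  exact ⟨hfin.toFinset, fun γ => by simp⟩

/-- The dimension inequality in a field extension of an algebraically closed field. -/
theorem hfs_field {K L : Type*} [Field K] [IsAlgClosed K] [Field L] [Algebra K L]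
    (V W U : Submodule K L) [FiniteDimensional K V] [FiniteDimensional K W]
    [FiniteDimensional K U] (hV : V ≠ ⊥) (hW : W ≠ ⊥)
    (hU : ∀ x ∈ V, ∀ y ∈ W, x * y ∈ U) :
    Module.finrank K V + Module.finrank K W - 1 ≤ Module.finrank K U := by
  classical
  obtain ⟨O, hK, hres⟩ := hfs_exists_place K L
  obtain ⟨S, hS⟩ := hfs_values O hK V
  obtain ⟨T, hT⟩ := hfs_values O hK W
  have hu : ∀ x : L, x ≠ 0 → ∃ γ : O.ValueGroupˣ, O.valuation x = γ := fun x hx =>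
    ⟨Units.mk0 _ ((O.valuation.ne_zero_iff).mpr hx), rfl⟩
  have key : ∀ (Z : Submodule K L) (F : Finset O.ValueGroupˣ),
      (∀ γ, γ ∈ F ↔ ∃ x ∈ Z, O.valuation x = γ) →
      ∀ x ∈ Z, x ≠ 0 → ∃ γ ∈ F, O.valuation x = γ := by
    intro Z F hF x hx hx0
    obtain ⟨γ, hγ⟩ := hu x hx0
    exact ⟨γ, (hF γ).mpr ⟨x, hx, hγ⟩, hγ⟩
  have h1 := hfs_le_card O hK hres S V (key V S hS)
  have h2 := hfs_le_card O hK hres T W (key W T hT)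
  obtain ⟨x, hx, hx0⟩ := V.ne_bot_iff.mp hV
  obtain ⟨y, hy, hy0⟩ := W.ne_bot_iff.mp hW
  obtain ⟨s, hs, -⟩ := key V S hS x hx hx0
  obtain ⟨t, ht, -⟩ := key W T hT y hy hy0
  open Pointwise in
  have h3 := cauchy_davenport_mul_of_linearOrder_isCancelMul (s := S) (t := T) ⟨s, hs⟩ ⟨t, ht⟩
  open Pointwise in
  have h4 := hfs_card_le O hK (S * T) U (by
    intro γ hγ
    obtain ⟨a, ha, b, hb, rfl⟩ := Finset.mem_mul.mp hγ
    obtain ⟨p, hp, hpa⟩ := (hS a).mp ha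
    obtain ⟨q, hq, hqb⟩ := (hT b).mp hb
    exact ⟨p * q, hU p hp q hq, by rw [map_mul, hpa, hqb, Units.val_mul]⟩)
  omega


/-- **Theorem (Cameron).** Let `A = ⊕ₙ Aₙ` be a commutative graded algebra over an
algebraically closed field `K` of characteristic zero, with finite-dimensional homogeneous
components, and suppose `A` is an integral domain.  Then, whenever `Aₙ ≠ 0` and `Aₘ ≠ 0`, the
Hilbert function `h_A(n) = dim_K Aₙ` satisfies `h_A(n) + h_A(m) - 1 ≤ h_A(n + m)`. -/
theorem hilbert_function_superadditive_of_domain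
    (K A : Type*) [Field K] [IsAlgClosed K] [CharZero K]
    [CommRing A] [IsDomain A] [Algebra K A]
    (𝒜 : ℕ → Submodule K A) [GradedAlgebra 𝒜]
    (hfd : ∀ n : ℕ, FiniteDimensional K (𝒜 n))
    (n m : ℕ) (hn : 𝒜 n ≠ ⊥) (hm : 𝒜 m ≠ ⊥) :
    Module.finrank K (𝒜 n) + Module.finrank K (𝒜 m) - 1 ≤
      Module.finrank K (𝒜 (n + m)) := by
  let L := FractionRing A
  let f : A →ₗ[K] L := (IsScalarTower.toAlgHom K A L).toLinearMap
  have hf : Function.Injective f := IsFractionRing.injective A L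
  have hr : ∀ k, Module.finrank K ((𝒜 k).map f) = Module.finrank K (𝒜 k) := fun k =>
    (LinearEquiv.finrank_eq (Submodule.equivMapOfInjective f hf (𝒜 k))).symm
  have hb : ∀ k, 𝒜 k ≠ ⊥ → (𝒜 k).map f ≠ ⊥ := by
    intro k hk h
    exact hk (Submodule.map_injective_of_injective hf (by rw [h, Submodule.map_bot]))
  have := hfs_field ((𝒜 n).map f) ((𝒜 m).map f) ((𝒜 (n + m)).map f) (hb n hn) (hb m hm) (by
    rintro _ ⟨a, ha, rfl⟩ _ ⟨b, hb, rfl⟩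
    exact ⟨a * b, SetLike.mul_mem_graded ha hb, map_mul (IsScalarTower.toAlgHom K A L) a b⟩)
  rwa [hr, hr, hr] at this
end

section
/- A relational structure R on a set E has empty kernel if and only if its age has the disjoint embedding property: for all finite subsets A and B of E there exist disjoint finite subsets A' and B' of E such that R↾A' is isomorphic to R↾A and R↾B' is isomorphic to R↾B. -/
open scoped Cardinal

universe u v

variable {α : Type u} {I : Type v}

/-- The kernel of a relational structure: the set of elements `x` such that some finite induced
substructure of `R` is not isomorphic to any finite induced substructure avoiding `x`. -/
def kernel (ar : I → ℕ) (rel : ∀ i, Set (Fin (ar i) → α)) : Set α :=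
  {x : α | ∃ F : Finset α, ∀ F' : Finset α, x ∉ F' →
    ¬ IsoOn ar rel (↑F' : Set α) (↑F : Set α)}

/-- Compactness for finite transversals of a family of finite sets. -/
theorem exists_finite_subfamily (k : ℕ) : ∀ H : Set (Finset α),
    (∀ S : Finset α, S.card < k → ∃ h ∈ H, Disjoint S h) →
    ∃ H0 : Set (Finset α), H0.Finite ∧ H0 ⊆ H ∧
      ∀ S : Finset α, S.card < k → ∃ h ∈ H0, Disjoint S h := by
  classical
  induction k with
  | zero => exact fun H _ => ⟨∅, Set.finite_empty, Set.empty_subset _, fun S hS => by omega⟩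
  | succ k ih =>
    intro H hH
    obtain ⟨e, he, -⟩ := hH ∅ (by simp)
    have key : ∀ x : α, ∃ H0 : Set (Finset α), H0.Finite ∧ H0 ⊆ {h ∈ H | x ∉ h} ∧
        ∀ S : Finset α, S.card < k → ∃ h ∈ H0, Disjoint S h := by
      intro x
      apply ih
      intro S hS
      obtain ⟨h, hh, hd⟩ := hH (insert x S) (by
        have := Finset.card_insert_le x S
        omega)
      rw [Finset.disjoint_insert_left] at hd
      exact ⟨h, ⟨hh, hd.1⟩, hd.2⟩
    choose K hKf hKs hKt using key
    refine ⟨insert e (⋃ x ∈ e, K x), ?_, ?_, ?_⟩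
    · exact (Set.Finite.biUnion e.finite_toSet (fun x _ => hKf x)).insert e
    · intro h hh
      rcases hh with rfl | hh
      · exact he
      · simp only [Set.mem_iUnion] at hh
        obtain ⟨x, _, hx⟩ := hh
        exact (hKs x hx).1
    · intro S hS
      by_cases hd : Disjoint S e
      · exact ⟨e, Set.mem_insert _ _, hd⟩
      · rw [Finset.not_disjoint_iff] at hd
        obtain ⟨x, hxS, hxe⟩ := hd
        obtain ⟨h, hh, hd⟩ := hKt x (S.erase x) (by
          have := Finset.card_erase_lt_of_mem hxS
          omega)
        refine ⟨h, Set.mem_insert_of_mem _ ?_, ?_⟩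
        · simp only [Set.mem_iUnion]
          exact ⟨x, hxe, hh⟩
        · rw [← Finset.insert_erase hxS, Finset.disjoint_insert_left]
          exact ⟨(hKs x hh).2, hd⟩

theorem IsoOn.refl' (ar : I → ℕ) (rel : ∀ i, Set (Fin (ar i) → α)) (A : Set α) :
    IsoOn ar rel A A :=
  ⟨id, Set.bijOn_id A, fun _ _ _ => Iff.rfl⟩

theorem IsoOn.trans' {ar : I → ℕ} {rel : ∀ i, Set (Fin (ar i) → α)} {A B C : Set α}
    (h1 : IsoOn ar rel A B) (h2 : IsoOn ar rel B C) : IsoOn ar rel A C := by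
  obtain ⟨f, hf, pf⟩ := h1
  obtain ⟨g, hg, pg⟩ := h2
  exact ⟨g ∘ f, hg.comp hf, fun i x hx =>
    (pf i x hx).trans (pg i (f ∘ x) (fun j => hf.mapsTo (hx j)))⟩

theorem exists_copy_disjoint (ar : I → ℕ) (rel : ∀ i, Set (Fin (ar i) → α))
    (hK : kernel ar rel = ∅) (F S : Finset α) :
    ∃ F' : Finset α, IsoOn ar rel (↑F' : Set α) (↑F : Set α) ∧ Disjoint S F' := by
  classical
  by_contra hcon
  let H : Set (Finset α) := {h | IsoOn ar rel (↑h : Set α) (↑F : Set α)}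
  have hex : ∃ k, ∃ S : Finset α, S.card = k ∧ ∀ h ∈ H, ¬ Disjoint S h :=
    ⟨_, S, rfl, fun h hh hd => hcon ⟨h, hh, hd⟩⟩
  obtain ⟨S0, hS0, hT⟩ := Nat.find_spec hex
  have hmin : ∀ S : Finset α, S.card < S0.card → ∃ h ∈ H, Disjoint S h := by
    intro S hS
    rw [hS0] at hS
    have := Nat.find_min hex hS
    by_contra hc
    exact this ⟨S, rfl, fun h hh hd => hc ⟨h, hh, hd⟩⟩
  obtain ⟨H0, hfin, hsub, hH0⟩ := exists_finite_subfamily _ H hmin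
  obtain ⟨x, hx, -⟩ := Finset.not_disjoint_iff.1 (hT F (IsoOn.refl' ar rel _))
  have hxK : x ∉ kernel ar rel := by simp [hK]
  have : ∃ G' : Finset α, x ∉ G' ∧
      IsoOn ar rel (↑G' : Set α) (↑(hfin.toFinset.biUnion id) : Set α) := by
    by_contra hc
    exact hxK ⟨_, fun F' h1 h2 => hc ⟨F', h1, h2⟩⟩
  obtain ⟨G', hxG, f, hf, pf⟩ := this
  obtain ⟨h, hh, hd⟩ := hH0 ((S0 ∩ G').image f) (by
    refine lt_of_le_of_lt Finset.card_image_le (Finset.card_lt_card ?_)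
    refine ⟨Finset.inter_subset_left, fun hc => hxG ?_⟩
    exact (Finset.mem_inter.1 (hc hx)).2)
  have hcopy : IsoOn ar rel (↑(G'.filter (fun y => f y ∈ h)) : Set α) (↑h : Set α) := by
    refine ⟨f, ⟨?_, ?_, ?_⟩, ?_⟩
    · intro y hy
      exact (Finset.mem_filter.1 hy).2
    · exact hf.injOn.mono (fun y hy => (Finset.mem_filter.1 hy).1)
    · intro z hz
      have hzG : z ∈ (↑(hfin.toFinset.biUnion id) : Set α) := by
        refine Finset.mem_coe.2 (Finset.mem_biUnion.2 ⟨h, ?_, hz⟩)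
        exact hfin.mem_toFinset.2 hh
      obtain ⟨y, hy, rfl⟩ := hf.surjOn hzG
      exact ⟨y, Finset.mem_coe.2 (Finset.mem_filter.2 ⟨hy, hz⟩), rfl⟩
    · exact fun i y hy => pf i y (fun j => (Finset.mem_filter.1 (hy j)).1)
  obtain ⟨y, hyS, hy⟩ := Finset.not_disjoint_iff.1 (hT _ (hcopy.trans' (hsub hh)))
  obtain ⟨hyG, hyh⟩ := Finset.mem_filter.1 hy
  exact Finset.disjoint_left.1 hd
    (Finset.mem_image_of_mem f (Finset.mem_inter.2 ⟨hyS, hyG⟩)) hyh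

/-- **Corollary.** A relational structure has empty kernel if and only if its age has the
disjoint embedding property: any two finite induced substructures have isomorphic copies on
disjoint finite subsets of the domain. -/
theorem kernel_empty_iff_disjoint_embedding
    (ar : I → ℕ) (rel : ∀ i, Set (Fin (ar i) → α)) :
    kernel ar rel = ∅ ↔
      ∀ A B : Finset α, ∃ A' B' : Finset α, Disjoint A' B' ∧
        IsoOn ar rel (↑A' : Set α) (↑A : Set α) ∧
        IsoOn ar rel (↑B' : Set α) (↑B : Set α) := by
  constructor
  · intro hK A B
    obtain ⟨A', hA, hd⟩ := exists_copy_disjoint ar rel hK A B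
    exact ⟨A', B, hd.symm, hA, IsoOn.refl' ar rel _⟩
  · intro h
    refine Set.eq_empty_iff_forall_notMem.2 ?_
    rintro x ⟨F, hF⟩
    obtain ⟨A', B', hd, hA, hB⟩ := h F F
    by_cases hx : x ∈ A'
    · exact hF B' (Finset.disjoint_left.1 hd hx) hB
    · exact hF A' hx hA
end
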